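/- arXiv:2204.02223 — 3 statements merged into one kernel-verified Lean document; each statement's English description precedes it below -/
import Mathlib

section
/- Let X be a complex Banach space and T a C₀-semigroup on X with ‖T(t)‖ ≤ M₀ e^{ω₀ t}. Let ω' ∈ ℝ and let R : D → L(X), where D := {Re λ ≥ ω'} ∪ {Re λ > ω₀}, satisfy the resolvent identity on D and the Laplace-transform identity R(λ)x = ∫₀^∞ e^{−λt} T(t)x dt for all λ with Re λ > max(ω₀, ω'). Assume sup_{Re λ ≥ ω'} ‖R(λ)‖ < ∞. Fix an integer m ≥ 0 and μ ∈ ℂ with Re μ > max(ω₀, ω'). Then the following are equivalent: (1) for every ω > ω' there exist p, q ∈ [1,∞] and C ≥ 0 such that ‖𝓕⁻¹(ξ ↦ R(ω + iξ)∘R(μ)^m · (𝓕f)(ξ))‖_{L^q(ℝ;X)} ≤ C ‖f‖_{L^p(ℝ;X)} for all X-valued Schwartz functions f on ℝ; (2) for every ω > ω' there exists C ≥ 0 with ‖T(t)∘R(μ)^m‖ ≤ C e^{ω t} for all t ≥ 0. Moreover, if these hold then (1) holds for all 1 ≤ p ≤ q ≤ ∞. (This is the Fourier-multiplier characterization of exponential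 decay, with the fractional-domain parameter α specialized to the integer m; composition with R(μ)^m realizes the graph norm of D(A^m).) -/
open MeasureTheory FourierTransform SchwartzMap ENNReal

/-- A weighted form of Jensen's inequality for powers. -/
theorem lintegral_mul_rpow_le_lintegral_mul_rpow {α : Type*} [MeasurableSpace α] (ν : Measure α)
    {k φ : α → ℝ≥0∞} (hk : AEMeasurable k ν) (hφ : AEMeasurable φ ν) {p : ℝ} (hp : 1 ≤ p) :
    (∫⁻ t, k t * φ t ∂ν) ^ p ≤ (∫⁻ t, k t ∂ν) ^ (p - 1) * ∫⁻ t, k t * φ t ^ p ∂ν := by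
  rcases hp.eq_or_lt with rfl | hp1
  · simp
  have hp0 : 0 < p := by linarith
  have hpq := (Real.HolderConjugate.conjExponent hp1).symm
  set r := p.conjExponent with hr
  have hr' : p / r = p - 1 := by rw [hr, Real.conjExponent]; field_simp
  have key := ENNReal.lintegral_mul_le_Lp_mul_Lq ν hpq (hk.pow_const (1 / r))
    ((hk.pow_const (1 / p)).mul hφ)
  have e1 : ∀ t, ((fun t => k t ^ (1 / r)) * ((fun t => k t ^ (1 / p)) * φ)) t = k t * φ t := by
    intro t
    simp only [Pi.mul_apply]
    rw [← mul_assoc, ← ENNReal.rpow_add_of_nonneg _ _ (by have := hpq.pos; positivity)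
      (by positivity), one_div, one_div, hpq.inv_add_inv_eq_one, ENNReal.rpow_one]
  have e2 : ∀ t, (k t ^ (1 / r)) ^ r = k t := by
    intro t
    rw [← ENNReal.rpow_mul, one_div_mul_cancel hpq.ne_zero, ENNReal.rpow_one]
  have e3 : ∀ t, (((fun t => k t ^ (1 / p)) * φ) t) ^ p = k t * φ t ^ p := by
    intro t
    simp only [Pi.mul_apply]
    rw [ENNReal.mul_rpow_of_nonneg _ _ hp0.le, ← ENNReal.rpow_mul,
      one_div_mul_cancel hp0.ne', ENNReal.rpow_one]
  simp only [e1, e2, e3] at key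
  calc (∫⁻ t, k t * φ t ∂ν) ^ p
      ≤ ((∫⁻ t, k t ∂ν) ^ (1 / r) * (∫⁻ t, k t * φ t ^ p ∂ν) ^ (1 / p)) ^ p :=
        ENNReal.rpow_le_rpow key hp0.le
    _ = _ := by
      rw [ENNReal.mul_rpow_of_nonneg _ _ hp0.le, ← ENNReal.rpow_mul, ← ENNReal.rpow_mul,
        one_div_mul_cancel hp0.ne', ENNReal.rpow_one, one_div_mul_eq_div, hr']

/-- Young's inequality `L^p → L^q`, `p ≤ q`, for a bounded integrable kernel. -/
theorem eLpNorm_le_of_enorm_le_lintegral_mul_comp_sub {E F : Type*} [NormedAddCommGroup E]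
    [NormedAddCommGroup F] {s : Set ℝ} (hs : MeasurableSet s) {k : ℝ → ℝ≥0∞} (hk : Measurable k)
    {A : ℝ≥0∞} (hkA : ∫⁻ t in s, k t ≤ A) (hkA' : ∀ t ∈ s, k t ≤ A) {f : ℝ → E}
    (hf : Continuous f) {g : ℝ → F} (hg : ∀ x, ‖g x‖ₑ ≤ ∫⁻ t in s, k t * ‖f (x - t)‖ₑ)
    {p q : ℝ≥0∞} (hp : 1 ≤ p) (hpq : p ≤ q) :
    eLpNorm g q volume ≤ A * eLpNorm f p volume := by
  have hmf : Measurable fun x => ‖f x‖ₑ := hf.enorm.measurable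
  by_cases hp' : p = ∞
  · subst hp'
    obtain rfl : q = ∞ := top_le_iff.1 hpq
    simp only [eLpNorm_exponent_top]
    refine eLpNormEssSup_le_of_ae_enorm_bound (Filter.Eventually.of_forall fun x => ?_)
    refine (hg x).trans ?_
    have h1 : ∀ᵐ t, ‖f (x - t)‖ₑ ≤ eLpNormEssSup f volume :=
      (quasiMeasurePreserving_sub_left volume x).ae
        (enorm_ae_le_eLpNormEssSup f volume)
    calc ∫⁻ t in s, k t * ‖f (x - t)‖ₑ
        ≤ ∫⁻ t in s, k t * eLpNormEssSup f volume := by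
          refine lintegral_mono_ae (ae_restrict_of_ae ?_)
          filter_upwards [h1] with t ht
          gcongr
      _ = (∫⁻ t in s, k t) * eLpNormEssSup f volume := lintegral_mul_const _ hk
      _ ≤ _ := by gcongr
  have hp0 : p ≠ 0 := (zero_lt_one.trans_le hp).ne'
  set P := p.toReal with hP
  have hP1 : 1 ≤ P := by
    rw [hP, ← ENNReal.toReal_one]
    exact ENNReal.toReal_mono hp' hp
  have hP0 : 0 < P := by linarith
  set I := ∫⁻ x, ‖f x‖ₑ ^ P with hI
  set N := A * eLpNorm f p volume with hN
  have hNp : N ^ P = A ^ P * I := by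
    rw [hN, ENNReal.mul_rpow_of_nonneg _ _ hP0.le, eLpNorm_eq_lintegral_rpow_enorm_toReal hp0 hp',
      ← ENNReal.rpow_mul, one_div_mul_cancel hP0.ne', ENNReal.rpow_one]
  have hAA : A ^ (P - 1) * A = A ^ P := by
    nth_rewrite 2 [← ENNReal.rpow_one A]
    rw [← ENNReal.rpow_add_of_nonneg _ _ (by linarith) zero_le_one, sub_add_cancel]
  have hmfs : ∀ x : ℝ, Measurable fun t => ‖f (x - t)‖ₑ := fun x =>
    hmf.comp (measurable_const.sub measurable_id)
  have hmfp : Measurable fun z : ℝ × ℝ => k z.2 * ‖f (z.1 - z.2)‖ₑ ^ P :=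
    (hk.comp measurable_snd).mul
      ((hmf.comp (measurable_fst.sub measurable_snd)).pow_const _)
  have hpow : ∀ x, ‖g x‖ₑ ^ P ≤ A ^ (P - 1) * ∫⁻ t in s, k t * ‖f (x - t)‖ₑ ^ P := by
    intro x
    refine (ENNReal.rpow_le_rpow (hg x) hP0.le).trans
      ((lintegral_mul_rpow_le_lintegral_mul_rpow _ hk.aemeasurable
        (hmfs x).aemeasurable hP1).trans ?_)
    gcongr
  have hsup : ∀ x, ‖g x‖ₑ ≤ N := by
    intro x
    rw [← ENNReal.rpow_le_rpow_iff hP0, hNp, ← hAA, mul_assoc]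
    refine (hpow x).trans ?_
    gcongr
    calc ∫⁻ t in s, k t * ‖f (x - t)‖ₑ ^ P
        ≤ ∫⁻ t in s, A * ‖f (x - t)‖ₑ ^ P := by
          refine setLIntegral_mono' hs fun t ht => ?_
          gcongr
          exact hkA' t ht
      _ ≤ ∫⁻ t, A * ‖f (x - t)‖ₑ ^ P := setLIntegral_le_lintegral _ _
      _ = A * ∫⁻ t, ‖f (x - t)‖ₑ ^ P := lintegral_const_mul _ ((hmfs x).pow_const _)
      _ = A * I := by rw [hI, lintegral_sub_left_eq_self (fun t => ‖f t‖ₑ ^ P) x]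
  have h_int : ∫⁻ x, ‖g x‖ₑ ^ P ≤ N ^ P := by
    calc ∫⁻ x, ‖g x‖ₑ ^ P ≤ ∫⁻ x, A ^ (P - 1) * ∫⁻ t in s, k t * ‖f (x - t)‖ₑ ^ P :=
          lintegral_mono hpow
      _ = A ^ (P - 1) * ∫⁻ x, ∫⁻ t in s, k t * ‖f (x - t)‖ₑ ^ P := by
          refine lintegral_const_mul _ ?_
          exact hmfp.lintegral_prod_right'
      _ = A ^ (P - 1) * ∫⁻ t in s, ∫⁻ x, k t * ‖f (x - t)‖ₑ ^ P := by
          rw [lintegral_lintegral_swap]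
          exact hmfp.aemeasurable
      _ = A ^ (P - 1) * ∫⁻ t in s, k t * I := by
          congr 1
          refine lintegral_congr fun t => ?_
          have hm : Measurable fun x => ‖f (x - t)‖ₑ ^ P :=
            (hmf.comp (measurable_id.sub measurable_const)).pow_const _
          rw [lintegral_const_mul _ hm, lintegral_sub_right_eq_self (fun x => ‖f x‖ₑ ^ P) t]
      _ = A ^ (P - 1) * ((∫⁻ t in s, k t) * I) := by rw [lintegral_mul_const _ hk]
      _ ≤ A ^ (P - 1) * (A * I) := by gcongr
      _ = N ^ P := by rw [← mul_assoc, hAA, hNp]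
  by_cases hNt : N = ∞
  · simp [hNt]
  by_cases hq : q = ∞
  · subst hq
    rw [eLpNorm_exponent_top]
    exact eLpNormEssSup_le_of_ae_enorm_bound (Filter.Eventually.of_forall hsup)
  have hq0 : q ≠ 0 := (hp.trans hpq |> zero_lt_one.trans_le).ne'
  have hPQ : P ≤ q.toReal := ENNReal.toReal_mono hq hpq
  rw [eLpNorm_eq_lintegral_rpow_enorm_toReal hq0 hq, one_div,
    ENNReal.rpow_inv_le_iff (by linarith)]
  have hsplit : ∀ a : ℝ≥0∞, a ^ q.toReal = a ^ P * a ^ (q.toReal - P) := fun a => by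
    rw [← ENNReal.rpow_add_of_nonneg _ _ hP0.le (by linarith), add_sub_cancel]
  calc ∫⁻ x, ‖g x‖ₑ ^ q.toReal ≤ ∫⁻ x, ‖g x‖ₑ ^ P * N ^ (q.toReal - P) := by
        refine lintegral_mono fun x => ?_
        rw [hsplit]
        gcongr
        exact hsup x
    _ = (∫⁻ x, ‖g x‖ₑ ^ P) * N ^ (q.toReal - P) :=
        lintegral_mul_const' _ _ (ENNReal.rpow_ne_top_of_nonneg (by linarith) hNt)
    _ ≤ N ^ P * N ^ (q.toReal - P) := by gcongr
    _ = _ := (hsplit N).symm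

/-- A locally bounded strongly continuous family of operators is jointly continuous. -/
theorem continuousOn_apply_of_strongly_continuousOn {X Y : Type*} [NormedAddCommGroup X]
    [NormedSpace ℂ X] [NormedAddCommGroup Y] [NormedSpace ℂ Y] {S : ℝ → X →L[ℂ] Y} {s : Set ℝ}
    {k : ℝ → ℝ} (hk : Continuous k) (hS : ∀ x, ContinuousOn (fun t => S t x) s)
    (hSk : ∀ t ∈ s, ‖S t‖ ≤ k t) :
    ContinuousOn (fun z : ℝ × X => S z.1 z.2) (s ×ˢ Set.univ) := by
  rintro ⟨t₀, x₀⟩ ⟨ht₀, -⟩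
  have hfst : Filter.Tendsto Prod.fst (nhdsWithin (t₀, x₀) (s ×ˢ Set.univ)) (nhdsWithin t₀ s) :=
    continuousWithinAt_fst.tendsto_nhdsWithin fun z hz => hz.1
  have h1 : Filter.Tendsto (fun z : ℝ × X => S z.1 x₀)
      (nhdsWithin (t₀, x₀) (s ×ˢ Set.univ)) (nhds (S t₀ x₀)) := (hS x₀ t₀ ht₀).tendsto.comp hfst
  have h2 : Filter.Tendsto (fun z : ℝ × X => S z.1 (z.2 - x₀))
      (nhdsWithin (t₀, x₀) (s ×ˢ Set.univ)) (nhds 0) := by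
    have h3 : Filter.Tendsto (fun z : ℝ × X => k z.1 * ‖z.2 - x₀‖)
        (nhdsWithin (t₀, x₀) (s ×ˢ Set.univ)) (nhds 0) := by
      have : Continuous (fun z : ℝ × X => k z.1 * ‖z.2 - x₀‖) := by fun_prop
      simpa using (this.tendsto (t₀, x₀)).mono_left nhdsWithin_le_nhds
    refine squeeze_zero_norm' ?_ h3
    filter_upwards [self_mem_nhdsWithin] with z hz
    exact (S z.1).le_of_opNorm_le (hSk _ hz.1) _
  simpa [ContinuousWithinAt] using h1.add h2

/-- If `N ξ` is the Fourier transform of an exponentially bounded strongly continuous family `S`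
on the half-line, then the Fourier multiplier with symbol `N` is convolution with `S`. -/
theorem fourierInv_apply_fourier_eq_setIntegral {X : Type*} [NormedAddCommGroup X]
    [NormedSpace ℂ X] [CompleteSpace X] {S N : ℝ → X →L[ℂ] X} {K ε : ℝ} (hε : 0 < ε)
    (hS : ∀ x, ContinuousOn (fun t => S t x) (Set.Ici 0))
    (hSK : ∀ t, 0 ≤ t → ‖S t‖ ≤ K * Real.exp (-ε * t))
    (hN : ∀ (ξ : ℝ) (x : X), N ξ x =
      ∫ t in Set.Ioi (0 : ℝ), Complex.exp (-(2 * Real.pi * Complex.I * ξ * t)) • S t x)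
    (f : 𝓢(ℝ, X)) (x : ℝ) :
    𝓕⁻ (fun ξ : ℝ => N ξ (𝓕 (⇑f) ξ)) x = ∫ t in Set.Ioi (0 : ℝ), S t (f (x - t)) := by
  have hcf : Continuous (𝓕 (⇑f)) := by
    rw [← SchwartzMap.fourier_coe]; exact (𝓕 f).continuous
  have hif : Integrable (𝓕 (⇑f)) := by
    rw [← SchwartzMap.fourier_coe]; exact (𝓕 f).integrable
  have hinv : ∀ y : ℝ, ∫ ξ : ℝ, Complex.exp (2 * Real.pi * Complex.I * ξ * y) • 𝓕 (⇑f) ξ = f y := by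
    intro y
    conv_rhs => rw [← f.continuous.fourierInv_fourier_eq f.integrable hif]
    rw [Real.fourierInv_eq']
    refine integral_congr_ae (Filter.Eventually.of_forall fun ξ => ?_)
    simp only [RCLike.inner_apply, conj_trivial]
    congr 2
    push_cast
    ring
  have hnorm : ∀ r : ℝ, ‖Complex.exp (2 * Real.pi * Complex.I * r)‖ = 1 := fun r => by
    rw [show (2 * Real.pi * Complex.I * r : ℂ) = ((2 * Real.pi * r : ℝ) : ℂ) * Complex.I by
      push_cast; ring, Complex.norm_exp_ofReal_mul_I]
  have hSint : ∀ {y : X}, IntegrableOn (fun t => S t y) (Set.Ioi 0) := by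
    intro y
    refine Integrable.mono' (((exp_neg_integrableOn_Ioi 0 hε).const_mul K).mul_const ‖y‖)
      (((hS y).mono Set.Ioi_subset_Ici_self).aestronglyMeasurable measurableSet_Ioi) ?_
    filter_upwards [ae_restrict_mem measurableSet_Ioi] with t ht
    exact (S t).le_of_opNorm_le (hSK t (le_of_lt ht)) y
  have hjoint := continuousOn_apply_of_strongly_continuousOn (S := S)
    (k := fun t => K * Real.exp (-ε * t)) (by fun_prop) hS hSK
  have hprod : Integrable (Function.uncurry fun (ξ t : ℝ) =>
      Complex.exp (2 * Real.pi * Complex.I * ξ * (x - t)) • S t (𝓕 (⇑f) ξ))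
      (volume.prod (volume.restrict (Set.Ioi 0))) := by
    refine Integrable.mono' (hif.norm.mul_prod ((exp_neg_integrableOn_Ioi 0 hε).const_mul K)) ?_ ?_
    · have hc : ContinuousOn (Function.uncurry fun (ξ t : ℝ) =>
          Complex.exp (2 * Real.pi * Complex.I * ξ * (x - t)) • S t (𝓕 (⇑f) ξ))
          (Set.univ ×ˢ Set.Ioi 0) := by
        unfold Function.uncurry
        refine ContinuousOn.smul (by fun_prop) ?_
        exact hjoint.comp (f := fun z : ℝ × ℝ => (z.2, 𝓕 (⇑f) z.1))
          (Continuous.continuousOn (by fun_prop)) fun z hz =>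
            ⟨le_of_lt (Set.mem_Ioi.1 hz.2), trivial⟩
      have := hc.aestronglyMeasurable (μ := (volume : Measure ℝ).prod volume)
        (MeasurableSet.univ.prod measurableSet_Ioi)
      rwa [← Measure.prod_restrict, Measure.restrict_univ] at this
    · have : ∀ᵐ z ∂((volume : Measure ℝ).prod (volume.restrict (Set.Ioi (0:ℝ)))), 0 < z.2 :=
        Measure.quasiMeasurePreserving_snd.ae (ae_restrict_mem measurableSet_Ioi)
      filter_upwards [this] with z hz
      simp only [Function.uncurry]
      rw [norm_smul, show (2 * Real.pi * Complex.I * z.1 * (x - z.2) : ℂ)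
        = 2 * Real.pi * Complex.I * ((z.1 * (x - z.2) : ℝ) : ℂ) by push_cast; ring, hnorm, one_mul,
        mul_comm]
      exact (S z.2).le_of_opNorm_le (hSK _ hz.le) _
  rw [Real.fourierInv_eq']
  calc ∫ ξ : ℝ, Complex.exp (↑(2 * Real.pi * inner ℝ ξ x) * Complex.I) • N ξ (𝓕 (⇑f) ξ)
      = ∫ ξ : ℝ, ∫ t in Set.Ioi (0 : ℝ),
          Complex.exp (2 * Real.pi * Complex.I * ξ * (x - t)) • S t (𝓕 (⇑f) ξ) := by
        refine integral_congr_ae (Filter.Eventually.of_forall fun ξ => ?_)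
        simp only [RCLike.inner_apply, conj_trivial]
        rw [hN, ← integral_smul]
        refine integral_congr_ae (Filter.Eventually.of_forall fun t => ?_)
        simp only [smul_smul, ← Complex.exp_add]
        congr 2
        push_cast
        ring
    _ = ∫ t in Set.Ioi (0 : ℝ), ∫ ξ : ℝ,
          Complex.exp (2 * Real.pi * Complex.I * ξ * (x - t)) • S t (𝓕 (⇑f) ξ) :=
        integral_integral_swap hprod
    _ = ∫ t in Set.Ioi (0 : ℝ), S t (f (x - t)) := by
        refine integral_congr_ae (Filter.Eventually.of_forall fun t => ?_)
        simp only
        rw [← hinv (x - t), ← ContinuousLinearMap.integral_comp_comm]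
        · simp
        · refine hif.norm.mono' (Continuous.aestronglyMeasurable (by fun_prop)) ?_
          refine Filter.Eventually.of_forall fun ξ => ?_
          rw [norm_smul, show (2 * Real.pi * Complex.I * ξ * ((x - t : ℝ) : ℂ) : ℂ)
            = 2 * Real.pi * Complex.I * ((ξ * (x - t) : ℝ) : ℂ) by push_cast; ring, hnorm, one_mul]

/-- Laplace-type integrals are holomorphic. -/
theorem differentiableAt_integral_exp_neg_mul_smul {E : Type*} [NormedAddCommGroup E]
    [NormedSpace ℂ E] {ν : Measure ℝ} {g : ℝ → E} (hg : AEStronglyMeasurable g ν) {l₀ : ℂ}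
    {δ : ℝ} (hδ : 0 < δ) (h1 : Integrable (fun t => Real.exp (-((l₀.re - δ) * t)) * ‖g t‖) ν)
    (h2 : Integrable (fun t => Real.exp (-((l₀.re + δ) * t)) * ‖g t‖) ν) :
    DifferentiableAt ℂ (fun l : ℂ => ∫ t, Complex.exp (-(l * t)) • g t ∂ν) l₀ := by
  have hexp : ∀ (l : ℂ) (t : ℝ), |l.re - l₀.re| ≤ δ / 2 →
      ‖Complex.exp (-(l * t))‖ * Real.exp (δ / 2 * |t|) ≤
        Real.exp (-((l₀.re - δ) * t)) + Real.exp (-((l₀.re + δ) * t)) := by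
    intro l t hl
    rw [Complex.norm_exp, ← Real.exp_add]
    have h3 : -(l.re * t) ≤ -(l₀.re * t) + δ / 2 * |t| := by
      have := (neg_le_abs ((l.re - l₀.re) * t)).trans_eq (abs_mul _ _)
      have := mul_le_mul_of_nonneg_right hl (abs_nonneg t)
      nlinarith
    have h4 : (-(l * t)).re = -(l.re * t) := by simp
    rw [h4]
    rcases le_total 0 t with ht | ht
    · rw [abs_of_nonneg ht] at h3 ⊢
      exact (Real.exp_le_exp.2 (by linarith)).trans (le_add_of_nonneg_right (Real.exp_pos _).le)
    · rw [abs_of_nonpos ht] at h3 ⊢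
      exact (Real.exp_le_exp.2 (by linarith)).trans (le_add_of_nonneg_left (Real.exp_pos _).le)
  have hm : ∀ l : ℂ, AEStronglyMeasurable (fun t : ℝ => Complex.exp (-(l * t)) • g t) ν :=
    fun l => (Continuous.aestronglyMeasurable (by fun_prop)).smul hg
  have hre : ∀ l ∈ Metric.ball l₀ (δ / 2), |l.re - l₀.re| ≤ δ / 2 := fun l hl => by
    rw [← Complex.sub_re]
    exact (Complex.abs_re_le_norm _).trans (mem_ball_iff_norm.1 hl).le
  refine (hasDerivAt_integral_of_dominated_loc_of_deriv_le (Metric.ball_mem_nhds l₀ (half_pos hδ))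
    (F' := fun (l : ℂ) (t : ℝ) => (Complex.exp (-(l * t)) * (-t)) • g t)
    (bound := fun t => 2 / δ * (Real.exp (-((l₀.re - δ) * t)) * ‖g t‖ +
      Real.exp (-((l₀.re + δ) * t)) * ‖g t‖)) (Filter.Eventually.of_forall hm) ?_ ?_ ?_
      ((h1.add h2).const_mul _) ?_).2.differentiableAt
  · refine (h1.add h2).mono' (hm l₀) (Filter.Eventually.of_forall fun t => ?_)
    rw [norm_smul, Pi.add_apply, ← add_mul]
    gcongr
    refine le_trans ?_ (hexp l₀ t (by rw [sub_self, abs_zero]; positivity))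
    exact le_mul_of_one_le_right (norm_nonneg _) (Real.one_le_exp (by positivity))
  · exact (Continuous.aestronglyMeasurable (by fun_prop)).smul hg
  · refine Filter.Eventually.of_forall fun t l hl => ?_
    rw [norm_smul, norm_mul, ← add_mul, ← mul_assoc]
    refine mul_le_mul_of_nonneg_right ?_ (norm_nonneg _)
    have h5 : |t| ≤ 2 / δ * Real.exp (δ / 2 * |t|) := by
      have := Real.add_one_le_exp (δ / 2 * |t|)
      calc |t| = 2 / δ * (δ / 2 * |t|) := by field_simp
        _ ≤ _ := by gcongr; linarith
    calc ‖Complex.exp (-(l * t))‖ * ‖(-t : ℂ)‖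
        ≤ ‖Complex.exp (-(l * t))‖ * (2 / δ * Real.exp (δ / 2 * |t|)) := by
          gcongr
          simpa using h5
      _ = 2 / δ * (‖Complex.exp (-(l * t))‖ * Real.exp (δ / 2 * |t|)) := by ring
      _ ≤ _ := by gcongr; exact hexp l t (hre l hl)
  · refine Filter.Eventually.of_forall fun t l _ => ?_
    refine HasDerivAt.smul_const ?_ _
    have : HasDerivAt (fun l : ℂ => -(l * t)) (-t) l := by
      simpa using ((hasDerivAt_id l).mul_const (t : ℂ)).fun_neg
    exact this.cexp

/-- Shifting a vertical line of integration. -/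
theorem integral_vertical_line_eq_of_differentiableOn {E : Type*} [NormedAddCommGroup E]
    [NormedSpace ℂ E] [CompleteSpace E] {H : ℂ → E} {a b K : ℝ} (hab : a ≤ b)
    (hd : DifferentiableOn ℂ H {z | a ≤ z.re ∧ z.re ≤ b})
    (hK : ∀ z : ℂ, a ≤ z.re → z.re ≤ b → |z.im| * ‖H z‖ ≤ K)
    (ha : Integrable fun y : ℝ => H (a + y * Complex.I))
    (hb : Integrable fun y : ℝ => H (b + y * Complex.I)) :
    ∫ y : ℝ, H (a + y * Complex.I) = ∫ y : ℝ, H (b + y * Complex.I) := by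
  have htend : ∀ c : ℝ, |c| = 1 → Filter.Tendsto
      (fun n : ℝ => ∫ x in a..b, H (x + (c * n : ℝ) * Complex.I)) Filter.atTop (nhds 0) := by
    intro c hc
    have h0 : Filter.Tendsto (fun n : ℝ => K / n * |b - a|) Filter.atTop (nhds 0) := by
      simpa using (tendsto_const_nhds.div_atTop Filter.tendsto_id).mul_const |b - a|
    refine squeeze_zero_norm' ?_ h0
    filter_upwards [Filter.eventually_gt_atTop 0] with n hn
    refine intervalIntegral.norm_integral_le_of_norm_le_const fun x hx => ?_
    rw [Set.uIoc_of_le hab] at hx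
    rw [le_div_iff₀ hn]
    have := hK (x + (c * n : ℝ) * Complex.I) (by simpa using hx.1.le) (by simpa using hx.2)
    rw [mul_comm]
    simpa [abs_mul, hc, abs_of_pos hn] using this
  have hrect : ∀ n : ℝ, (∫ x in a..b, H (x + ((-1) * n : ℝ) * Complex.I)) -
      (∫ x in a..b, H (x + (1 * n : ℝ) * Complex.I)) +
      Complex.I • (∫ y in (-n)..n, H (b + y * Complex.I)) -
      Complex.I • (∫ y in (-n)..n, H (a + y * Complex.I)) = 0 := by
    intro n
    have := Complex.integral_boundary_rect_eq_zero_of_differentiableOn H ⟨a, -n⟩ ⟨b, n⟩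
      (hd.mono fun z hz => by
        have := hz.1
        simpa [Set.uIcc_of_le hab] using this)
    simpa using this
  have hlim := (((htend (-1) (by simp)).sub (htend 1 (by simp))).add
    ((intervalIntegral_tendsto_integral hb Filter.tendsto_neg_atTop_atBot
      Filter.tendsto_id).const_smul
      Complex.I)).sub
    ((intervalIntegral_tendsto_integral ha Filter.tendsto_neg_atTop_atBot
      Filter.tendsto_id).const_smul
      Complex.I)
  have h0 := tendsto_nhds_unique hlim (by
    simp only [id, hrect]
    exact tendsto_const_nhds)
  rw [sub_zero, zero_add, ← smul_sub, smul_eq_zero, sub_eq_zero] at h0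
  exact (h0.resolve_left Complex.I_ne_zero).symm

/-- A strongly continuous operator semigroup with `‖T t‖ ≤ M₀ e^{ω₀ t}`. -/
structure IsExpBoundedSemigroup {X : Type*} [NormedAddCommGroup X] [NormedSpace ℂ X]
    (T : ℝ → (X →L[ℂ] X)) (M₀ ω₀ : ℝ) : Prop where
  map_zero : T 0 = 1
  map_add : ∀ s t : ℝ, 0 ≤ s → 0 ≤ t → T (s + t) = (T s).comp (T t)
  continuousOn : ∀ x : X, ContinuousOn (fun t => T t x) (Set.Ici 0)
  norm_le : ∀ t : ℝ, 0 ≤ t → ‖T t‖ ≤ M₀ * Real.exp (ω₀ * t)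

/-- A bounded pseudo-resolvent on a half-plane is holomorphic in the interior. -/
theorem differentiableOn_of_resolvent_identity {X : Type*} [NormedAddCommGroup X]
    [NormedSpace ℂ X] {R : ℂ → (X →L[ℂ] X)} {w C₀ : ℝ}
    (hres : ∀ l μ : ℂ, w ≤ l.re → w ≤ μ.re → R l - R μ = (μ - l) • ((R l).comp (R μ)))
    (hbdd : ∀ l : ℂ, w ≤ l.re → ‖R l‖ ≤ C₀) : DifferentiableOn ℂ R {l | w < l.re} := by
  intro l₀ hl₀
  have hl₀' : w ≤ l₀.re := le_of_lt hl₀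
  have hC₀ : 0 ≤ C₀ := (norm_nonneg _).trans (hbdd l₀ hl₀')
  have hnhds : ∀ᶠ l in nhds l₀, w ≤ l.re := by
    filter_upwards [(isOpen_lt continuous_const Complex.continuous_re).mem_nhds hl₀] with l hl
    exact le_of_lt hl
  have hcont : Filter.Tendsto R (nhds l₀) (nhds (R l₀)) := by
    rw [tendsto_iff_norm_sub_tendsto_zero]
    have h0 : Filter.Tendsto (fun l => ‖l₀ - l‖ * (C₀ * C₀)) (nhds l₀) (nhds 0) := by
      have : Continuous fun l => ‖l₀ - l‖ * (C₀ * C₀) := by fun_prop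
      simpa using this.tendsto l₀
    refine squeeze_zero' (Filter.Eventually.of_forall fun _ => norm_nonneg _) ?_ h0
    filter_upwards [hnhds] with l hl
    rw [hres l l₀ hl hl₀', norm_smul]
    gcongr
    refine (ContinuousLinearMap.opNorm_comp_le _ _).trans ?_
    gcongr
    exacts [hbdd l hl, hbdd l₀ hl₀']
  have hderiv : HasDerivAt R (-((R l₀).comp (R l₀))) l₀ := by
    rw [hasDerivAt_iff_tendsto_slope]
    have h1 : Filter.Tendsto (fun l => -((R l).comp (R l₀))) (nhdsWithin l₀ {l₀}ᶜ)
        (nhds (-((R l₀).comp (R l₀)))) :=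
      ((((continuous_id.clm_comp continuous_const).tendsto (R l₀)).comp hcont).mono_left
        nhdsWithin_le_nhds).neg
    refine h1.congr' ?_
    filter_upwards [nhdsWithin_le_nhds hnhds, self_mem_nhdsWithin] with l hl hne
    have hne' : l - l₀ ≠ 0 := sub_ne_zero.2 hne
    rw [slope_def_module, hres l l₀ hl hl₀', smul_smul, ← neg_sub l l₀, mul_neg,
      inv_mul_cancel₀ hne', neg_one_smul]
  exact hderiv.differentiableAt.differentiableWithinAt

/-- Operators commuting with the semigroup's Laplace transform. -/
theorem IsExpBoundedSemigroup.comp_eq_comp_of_laplace {X : Type*} [NormedAddCommGroup X]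
    [NormedSpace ℂ X] [CompleteSpace X] {T : ℝ → (X →L[ℂ] X)} {M₀ ω₀ : ℝ}
    (hT : IsExpBoundedSemigroup T M₀ ω₀) {Q : X →L[ℂ] X} {l : ℂ} (hl : ω₀ < l.re)
    (hQ : ∀ x : X, Q x = ∫ t in Set.Ioi (0 : ℝ), Complex.exp (-(l * t)) • T t x) {t : ℝ}
    (ht : 0 ≤ t) : Commute (T t) Q := by
  ext x
  change T t (Q x) = Q (T t x)
  rw [hQ, hQ, ← ContinuousLinearMap.integral_comp_comm]
  · refine setIntegral_congr_fun measurableSet_Ioi fun s hs => ?_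
    have hs' : (0 : ℝ) ≤ s := le_of_lt hs
    have h1 := congrArg (fun A => A x) (hT.map_add s t hs' ht)
    have h2 := congrArg (fun A => A x) (hT.map_add t s ht hs')
    rw [add_comm] at h2
    simp only [ContinuousLinearMap.comp_apply] at h1 h2
    simp only [map_smul, ← h2, h1]
  · have hc := (hT.continuousOn x).mono Set.Ioi_subset_Ici_self
    refine Integrable.mono'
      (((exp_neg_integrableOn_Ioi 0 (sub_pos.2 hl)).const_mul M₀).mul_const ‖x‖)
      ((ContinuousOn.smul (by fun_prop) hc).aestronglyMeasurable measurableSet_Ioi) ?_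
    filter_upwards [ae_restrict_mem measurableSet_Ioi] with s hs
    rw [norm_smul, Complex.norm_exp]
    have h1 := (T s).le_of_opNorm_le (hT.norm_le s (le_of_lt hs)) x
    calc Real.exp (-(l * s)).re * ‖T s x‖
        ≤ Real.exp (-(l * s)).re * (M₀ * Real.exp (ω₀ * s) * ‖x‖) := by gcongr
      _ = M₀ * (Real.exp (-(l * s)).re * Real.exp (ω₀ * s)) * ‖x‖ := by ring
      _ = M₀ * Real.exp (-(l.re - ω₀) * s) * ‖x‖ := by
          rw [← Real.exp_add]
          congr 3
          simp
          ring

/-- Analytic continuation of a Laplace-transform identity. -/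
theorem eq_integral_exp_neg_mul_smul_of_differentiableOn {E : Type*} [NormedAddCommGroup E]
    [NormedSpace ℂ E] [CompleteSpace E] {Q : ℂ → E} {g : ℝ → E} {w b C : ℝ}
    (hQ : DifferentiableOn ℂ Q {l | w < l.re}) (hg : ContinuousOn g (Set.Ici 0))
    (hgC : ∀ t, 0 ≤ t → ‖g t‖ ≤ C * Real.exp (w * t))
    (hb : ∀ l : ℂ, b < l.re → Q l = ∫ t in Set.Ioi (0 : ℝ), Complex.exp (-(l * t)) • g t)
    {l : ℂ} (hl : w < l.re) : Q l = ∫ t in Set.Ioi (0 : ℝ), Complex.exp (-(l * t)) • g t := by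
  have hgm := (hg.mono Set.Ioi_subset_Ici_self).aestronglyMeasurable (μ := volume) measurableSet_Ioi
  have h_int : ∀ a : ℝ, w < a →
      Integrable (fun t => Real.exp (-(a * t)) * ‖g t‖) (volume.restrict (Set.Ioi 0)) := by
    intro a ha
    refine Integrable.mono' ((exp_neg_integrableOn_Ioi 0 (sub_pos.2 ha)).const_mul C)
      ((Continuous.aestronglyMeasurable (by fun_prop)).mul hgm.norm) ?_
    filter_upwards [ae_restrict_mem measurableSet_Ioi] with t ht
    rw [Real.norm_of_nonneg (by positivity)]
    calc Real.exp (-(a * t)) * ‖g t‖ ≤ Real.exp (-(a * t)) * (C * Real.exp (w * t)) := by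
          gcongr; exact hgC t (le_of_lt ht)
      _ = C * (Real.exp (-(a * t)) * Real.exp (w * t)) := by ring
      _ = _ := by
          rw [← Real.exp_add]
          congr 2
          ring
  have hopen : IsOpen {l : ℂ | w < l.re} := isOpen_lt continuous_const Complex.continuous_re
  have hd : DifferentiableOn ℂ
      (fun l : ℂ => ∫ t in Set.Ioi (0 : ℝ), Complex.exp (-(l * t)) • g t) {l | w < l.re} := by
    intro l₀ hl₀
    have hl₀' : w < l₀.re := hl₀
    exact (differentiableAt_integral_exp_neg_mul_smul hgm (δ := (l₀.re - w) / 2) (by linarith)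
      (h_int _ (by linarith)) (h_int _ (by linarith))).differentiableWithinAt
  have hz : ((max w b + 1 : ℝ) : ℂ) ∈ {l : ℂ | w < l.re} := by
    simpa using (le_max_left w b).trans_lt (lt_add_one _)
  refine (hQ.analyticOnNhd hopen).eqOn_of_preconnected_of_eventuallyEq (hd.analyticOnNhd hopen)
    (convex_halfSpace_re_gt w).isPreconnected hz ?_ hl
  have hz' : b < ((max w b + 1 : ℝ) : ℂ).re := by
    simpa using (le_max_right w b).trans_lt (lt_add_one _)
  filter_upwards [(isOpen_lt continuous_const Complex.continuous_re).mem_nhds hz'] with l hl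
  exact hb l hl

/-- On a vertical line where `Q` is the Laplace transform of `S`, the multiplier with symbol `Q`
is convolution with a rescaled exponentially weighted `S`. -/
theorem fourierInv_laplace_apply_fourier {X : Type*} [NormedAddCommGroup X]
    [NormedSpace ℂ X] [CompleteSpace X] {S : ℝ → X →L[ℂ] X} {Q : ℂ → X →L[ℂ] X} {C w ω : ℝ}
    (hω : w < ω) (hS : ∀ x, ContinuousOn (fun t => S t x) (Set.Ici 0))
    (hSC : ∀ t, 0 ≤ t → ‖S t‖ ≤ C * Real.exp (w * t))
    (hQ : ∀ (l : ℂ), w < l.re → ∀ x : X,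
      Q l x = ∫ t in Set.Ioi (0 : ℝ), Complex.exp (-(l * t)) • S t x)
    (f : 𝓢(ℝ, X)) (x : ℝ) :
    𝓕⁻ (fun ξ : ℝ => Q (ω + ξ * Complex.I) (𝓕 (⇑f) ξ)) x = ∫ t in Set.Ioi (0 : ℝ),
      (2 * Real.pi * Real.exp (-(2 * Real.pi * ω * t))) • S (2 * Real.pi * t) (f (x - t)) := by
  have hpi := Real.pi_pos
  set S' : ℝ → X →L[ℂ] X := fun t =>
    (2 * Real.pi * Real.exp (-(2 * Real.pi * ω * t))) • S (2 * Real.pi * t) with hS'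
  refine fourierInv_apply_fourier_eq_setIntegral (S := S') (K := 2 * Real.pi * C)
    (ε := 2 * Real.pi * (ω - w)) (mul_pos (by positivity) (sub_pos.2 hω)) ?_ ?_ ?_ f x
  · intro y
    change ContinuousOn (fun t => (2 * Real.pi * Real.exp (-(2 * Real.pi * ω * t))) •
      S (2 * Real.pi * t) y) _
    have hc : Continuous fun t : ℝ => 2 * Real.pi * Real.exp (-(2 * Real.pi * ω * t)) := by
      fun_prop
    refine hc.continuousOn.smul ?_
    refine (hS y).comp (f := fun t : ℝ => 2 * Real.pi * t) (by fun_prop) fun t ht => ?_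
    have ht' : (0 : ℝ) ≤ t := ht
    exact Set.mem_Ici.2 (by positivity)
  · intro t ht
    rw [hS', norm_smul, Real.norm_of_nonneg (by positivity)]
    calc 2 * Real.pi * Real.exp (-(2 * Real.pi * ω * t)) * ‖S (2 * Real.pi * t)‖
        ≤ 2 * Real.pi * Real.exp (-(2 * Real.pi * ω * t)) *
          (C * Real.exp (w * (2 * Real.pi * t))) := by
          gcongr; exact hSC _ (by positivity)
      _ = 2 * Real.pi * C * (Real.exp (-(2 * Real.pi * ω * t)) *
          Real.exp (w * (2 * Real.pi * t))) := by ring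
      _ = _ := by
          rw [← Real.exp_add]
          congr 2
          ring
  · intro ξ y
    rw [hQ _ (by simpa using hω)]
    have := integral_comp_mul_left_Ioi
      (fun t : ℝ => Complex.exp (-((ω + ξ * Complex.I) * t)) • S t y) 0 (b := 2 * Real.pi)
      (by positivity)
    rw [mul_zero, eq_inv_smul_iff₀ (by positivity)] at this
    rw [← this, ← integral_smul]
    refine integral_congr_ae (Filter.Eventually.of_forall fun t => ?_)
    simp only [hS', _root_.smul_apply, ← Complex.coe_smul, smul_smul]
    congr 1
    push_cast
    rw [mul_left_comm (Complex.exp _), ← Complex.exp_add]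
    congr 2
    ring

/-- If `S` decays faster than `e^{ωt}`, then the multiplier given by its Laplace transform on
`Re = ω` is bounded from `L^p` to `L^q` for all `p ≤ q`. -/
theorem exists_eLpNorm_fourierInv_laplace_le {X : Type*} [NormedAddCommGroup X]
    [NormedSpace ℂ X] [CompleteSpace X] {S : ℝ → X →L[ℂ] X} {Q : ℂ → X →L[ℂ] X} {C w ω : ℝ}
    (hω : w < ω) (hS : ∀ x, ContinuousOn (fun t => S t x) (Set.Ici 0))
    (hSC : ∀ t, 0 ≤ t → ‖S t‖ ≤ C * Real.exp (w * t))
    (hQ : ∀ (l : ℂ), w < l.re → ∀ x : X,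
      Q l x = ∫ t in Set.Ioi (0 : ℝ), Complex.exp (-(l * t)) • S t x)
    {p q : ℝ≥0∞} (hp : 1 ≤ p) (hpq : p ≤ q) :
    ∃ A : ℝ, 0 ≤ A ∧ ∀ f : 𝓢(ℝ, X),
      eLpNorm (𝓕⁻ fun ξ : ℝ => Q (ω + ξ * Complex.I) (𝓕 (⇑f) ξ)) q volume ≤
        ENNReal.ofReal A * eLpNorm (⇑f) p volume := by
  have hpi := Real.pi_pos
  have hC : 0 ≤ C := by simpa using (norm_nonneg _).trans (hSC 0 le_rfl)
  set ε := 2 * Real.pi * (ω - w) with hε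
  have hε0 : 0 < ε := mul_pos (by positivity) (sub_pos.2 hω)
  set k : ℝ → ℝ := fun t => 2 * Real.pi * C * Real.exp (-ε * t) with hk
  have hk0 : ∀ t, 0 ≤ k t := fun t => by positivity
  have hkint : IntegrableOn k (Set.Ioi 0) := (exp_neg_integrableOn_Ioi 0 hε0).const_mul _
  refine ⟨max (∫ t in Set.Ioi (0 : ℝ), k t) (2 * Real.pi * C), le_max_of_le_right (by positivity),
    fun f => ?_⟩
  refine eLpNorm_le_of_enorm_le_lintegral_mul_comp_sub (s := Set.Ioi 0) measurableSet_Ioi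
    (k := fun t => ENNReal.ofReal (k t)) (Measurable.ennreal_ofReal (by fun_prop)) ?_ ?_
    f.continuous ?_ hp hpq
  · rw [← ofReal_integral_eq_lintegral_ofReal hkint (Filter.Eventually.of_forall hk0)]
    exact ENNReal.ofReal_le_ofReal (le_max_left _ _)
  · intro t ht
    refine ENNReal.ofReal_le_ofReal (le_max_of_le_right ?_)
    refine mul_le_of_le_one_right (by positivity) (Real.exp_le_one_iff.2 ?_)
    have : 0 < ε * t := mul_pos hε0 ht
    linarith
  · intro x
    rw [fourierInv_laplace_apply_fourier hω hS hSC hQ f x]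
    refine (enorm_integral_le_lintegral_enorm _).trans (setLIntegral_mono' measurableSet_Ioi
      fun t ht => ?_)
    have ht' : (0 : ℝ) < t := ht
    rw [← ofReal_norm, ← ofReal_norm, ← ENNReal.ofReal_mul (hk0 t)]
    refine ENNReal.ofReal_le_ofReal ?_
    rw [norm_smul, Real.norm_of_nonneg (by positivity)]
    calc 2 * Real.pi * Real.exp (-(2 * Real.pi * ω * t)) * ‖S (2 * Real.pi * t) (f (x - t))‖
        ≤ 2 * Real.pi * Real.exp (-(2 * Real.pi * ω * t)) *
          (C * Real.exp (w * (2 * Real.pi * t)) * ‖f (x - t)‖) := by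
          gcongr
          exact (S _).le_of_opNorm_le (hSC _ (by positivity)) _
      _ = 2 * Real.pi * C * (Real.exp (-(2 * Real.pi * ω * t)) *
          Real.exp (w * (2 * Real.pi * t))) * ‖f (x - t)‖ := by ring
      _ = _ := by
          rw [← Real.exp_add, hk]
          congr 3
          rw [hε]
          ring

/-- The exponentially weighted inverse Fourier transforms along two vertical lines agree. -/
theorem exp_smul_fourierInv_apply_fourier_eq {X : Type*} [NormedAddCommGroup X]
    [NormedSpace ℂ X] [CompleteSpace X] {Q : ℂ → X →L[ℂ] X} {w C₀ : ℝ}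
    (hQ : DifferentiableOn ℂ Q {l | w < l.re}) (hQC : ∀ l : ℂ, w < l.re → ‖Q l‖ ≤ C₀)
    {G : ℝ → X} (hG : ContDiff ℝ 1 G) (hGc : HasCompactSupport G) {a b : ℝ} (ha : w < a)
    (hab : a ≤ b) {fa fb : 𝓢(ℝ, X)}
    (hfa : ∀ s, fa s = Real.exp (-(2 * Real.pi * a * s)) • G s)
    (hfb : ∀ s, fb s = Real.exp (-(2 * Real.pi * b * s)) • G s) (x : ℝ) :
    Real.exp (2 * Real.pi * a * x) • 𝓕⁻ (fun ξ : ℝ => Q (a + ξ * Complex.I) (𝓕 (⇑fa) ξ)) x =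
      Real.exp (2 * Real.pi * b * x) • 𝓕⁻ (fun ξ : ℝ => Q (b + ξ * Complex.I) (𝓕 (⇑fb) ξ)) x := by
  have hpi := Real.pi_pos
  have hC₀ : 0 ≤ C₀ := (norm_nonneg _).trans (hQC a (by simpa using ha))
  set F : ℂ → X := fun l => ∫ s : ℝ, Complex.exp (-(2 * Real.pi * l * s)) • G s with hF
  set H : ℂ → X := fun l => Complex.exp (2 * Real.pi * l * x) • Q l (F l) with hH
  have hFd : Differentiable ℂ F := by
    intro l₀
    have h_int : ∀ c : ℝ, Integrable fun s => Real.exp (-(c * s)) * ‖G s‖ := fun c =>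
      Continuous.integrable_of_hasCompactSupport (by fun_prop) hGc.norm.mul_left
    have := (differentiableAt_integral_exp_neg_mul_smul (ν := volume)
      hG.continuous.aestronglyMeasurable (l₀ := 2 * Real.pi * l₀) one_pos (h_int _) (h_int _)).comp
      l₀
      (differentiableAt_id.const_mul (2 * Real.pi : ℂ))
    exact this
  have hHd : DifferentiableOn ℂ H {l | w < l.re} :=
    DifferentiableOn.smul (by fun_prop) (hQ.clm_apply hFd.differentiableOn)
  have hFf : ∀ (c : ℝ) (f : 𝓢(ℝ, X)), (∀ s, f s = Real.exp (-(2 * Real.pi * c * s)) • G s) →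
      ∀ ξ : ℝ, 𝓕 (⇑f) ξ = F (c + ξ * Complex.I) := by
    intro c f hf ξ
    rw [Real.fourier_eq', hF]
    refine integral_congr_ae (Filter.Eventually.of_forall fun s => ?_)
    simp only [RCLike.inner_apply, conj_trivial, hf, ← Complex.coe_smul, smul_smul]
    congr 1
    push_cast
    rw [← Complex.exp_add]
    congr 1
    ring
  have hline : ∀ (c : ℝ) (f : 𝓢(ℝ, X)), (∀ s, f s = Real.exp (-(2 * Real.pi * c * s)) • G s) →
      Real.exp (2 * Real.pi * c * x) • 𝓕⁻ (fun ξ : ℝ => Q (c + ξ * Complex.I) (𝓕 (⇑f) ξ)) x =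
      ∫ ξ : ℝ, H (c + ξ * Complex.I) := by
    intro c f hf
    rw [Real.fourierInv_eq', ← integral_smul]
    refine integral_congr_ae (Filter.Eventually.of_forall fun ξ => ?_)
    simp only [RCLike.inner_apply, conj_trivial, hFf c f hf, hH, ← Complex.coe_smul, smul_smul]
    congr 1
    push_cast
    rw [← Complex.exp_add]
    congr 1
    ring
  have hline_int : ∀ (c : ℝ) (f : 𝓢(ℝ, X)), w < c →
      (∀ s, f s = Real.exp (-(2 * Real.pi * c * s)) • G s) →
      Integrable fun ξ : ℝ => H (c + ξ * Complex.I) := by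
    intro c f hc hf
    have hif : Integrable (𝓕 (⇑f)) := by
      rw [← SchwartzMap.fourier_coe]; exact (𝓕 f).integrable
    have hcont : Continuous fun ξ : ℝ => H (c + ξ * Complex.I) :=
      hHd.continuousOn.comp_continuous (by fun_prop) fun ξ => by simpa using hc
    refine (hif.norm.const_mul (Real.exp (2 * Real.pi * c * x) * C₀)).mono'
      hcont.aestronglyMeasurable (Filter.Eventually.of_forall fun ξ => ?_)
    rw [hFf c f hf, hH, norm_smul, Complex.norm_exp, mul_assoc (Real.exp (2 * Real.pi * c * x))]
    gcongr
    · simp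
    · exact (Q _).le_of_opNorm_le (hQC _ (by simpa using hc)) _
  have hexp : ∀ (l : ℂ) (s : ℝ), a ≤ l.re → l.re ≤ b → Real.exp (2 * Real.pi * l.re * s) ≤
      Real.exp (2 * Real.pi * a * s) + Real.exp (2 * Real.pi * b * s) := by
    intro l s hla hlb
    rcases le_total 0 s with hs | hs
    · refine le_trans (Real.exp_le_exp.2 ?_) (le_add_of_nonneg_left (Real.exp_pos _).le)
      gcongr
    · refine le_trans (Real.exp_le_exp.2 ?_) (le_add_of_nonneg_right (Real.exp_pos _).le)
      refine mul_le_mul_of_nonpos_right ?_ hs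
      gcongr
  have hG'c : Continuous (deriv G) := hG.continuous_deriv le_rfl
  have hGd : ∀ s, HasDerivAt G (deriv G s) s := fun s =>
    (hG.differentiable one_ne_zero s).hasDerivAt
  have hparts : ∀ l : ℂ, (2 * Real.pi * l) • F l =
      ∫ s : ℝ, Complex.exp (-(2 * Real.pi * l * s)) • deriv G s := by
    intro l
    have hi1 : Integrable fun s : ℝ => Complex.exp (-(2 * Real.pi * l * s)) • G s :=
      Continuous.integrable_of_hasCompactSupport (by fun_prop) hGc.smul_left
    have hi2 : Integrable fun s : ℝ => Complex.exp (-(2 * Real.pi * l * s)) • deriv G s :=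
      Continuous.integrable_of_hasCompactSupport (by fun_prop) hGc.deriv.smul_left
    have hd : ∀ s : ℝ, HasDerivAt (fun s : ℝ => Complex.exp (-(2 * Real.pi * l * s)) • G s)
        (Complex.exp (-(2 * Real.pi * l * s)) • deriv G s -
          (2 * Real.pi * l) • Complex.exp (-(2 * Real.pi * l * s)) • G s) s := by
      intro s
      have h1 : HasDerivAt (fun s : ℝ => -(2 * Real.pi * l * s)) (-(2 * Real.pi * l)) s := by
        simpa using ((Complex.ofRealCLM.hasDerivAt (x := s)).const_mul (2 * Real.pi * l)).fun_neg
      refine HasDerivAt.congr_deriv (h1.cexp.smul (hGd s)) ?_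
      rw [smul_smul, mul_neg, neg_smul, sub_eq_add_neg,
        mul_comm (2 * Real.pi * l) (Complex.exp _)]
    have hi3 : Integrable fun s : ℝ =>
        (2 * Real.pi * l) • Complex.exp (-(2 * Real.pi * l * s)) • G s := hi1.smul _
    have := integral_eq_zero_of_hasDerivAt_of_integrable hd (hi2.sub hi3) hi1
    rw [integral_sub hi2 hi3, integral_smul, sub_eq_zero] at this
    exact this.symm
  have hsub : ∀ l : ℂ, a ≤ l.re → w < l.re := fun l hl => ha.trans_le hl
  rw [hline a fa hfa, hline b fb hfb]
  set K₁ := ∫ s : ℝ, (Real.exp (2 * Real.pi * a * (-s)) + Real.exp (2 * Real.pi * b * (-s))) *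
    ‖deriv G s‖ with hK₁
  refine integral_vertical_line_eq_of_differentiableOn (K :=
    (Real.exp (2 * Real.pi * a * x) + Real.exp (2 * Real.pi * b * x)) * (C₀ * K₁)) hab
    (hHd.mono fun l hl => hsub l hl.1) ?_
    (hline_int a fa ha hfa) (hline_int b fb (ha.trans_le hab) hfb)
  intro l hla hlb
  have hFK : |l.im| * ‖F l‖ ≤ K₁ := by
    calc |l.im| * ‖F l‖ ≤ ‖(2 * Real.pi * l : ℂ)‖ * ‖F l‖ := by
          gcongr
          refine (Complex.abs_im_le_norm l).trans ?_
          rw [norm_mul]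
          refine le_mul_of_one_le_left (norm_nonneg _) ?_
          rw [norm_mul, Complex.norm_real, Real.norm_of_nonneg hpi.le]
          simp only [Complex.norm_ofNat]
          linarith [Real.pi_gt_three]
      _ = ‖∫ s : ℝ, Complex.exp (-(2 * Real.pi * l * s)) • deriv G s‖ := by
          rw [← norm_smul, hparts]
      _ ≤ K₁ := by
          refine norm_integral_le_of_norm_le
            (Continuous.integrable_of_hasCompactSupport (by fun_prop) hGc.deriv.norm.mul_left)
            (Filter.Eventually.of_forall fun s => ?_)
          rw [norm_smul, Complex.norm_exp]
          gcongr
          refine le_trans (le_of_eq ?_) (hexp l (-s) hla hlb)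
          simp
  calc |l.im| * ‖H l‖ = ‖Complex.exp (2 * Real.pi * l * x)‖ * (|l.im| * ‖Q l (F l)‖) := by
        rw [hH, norm_smul]; ring
    _ ≤ (Real.exp (2 * Real.pi * a * x) + Real.exp (2 * Real.pi * b * x)) *
          (|l.im| * (C₀ * ‖F l‖)) := by
        gcongr
        · refine le_trans (le_of_eq ?_) (hexp l x hla hlb)
          simp [Complex.norm_exp]
        · exact (Q _).le_of_opNorm_le (hQC _ (hsub l hla)) _
    _ = (Real.exp (2 * Real.pi * a * x) + Real.exp (2 * Real.pi * b * x)) *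
          (C₀ * (|l.im| * ‖F l‖)) := by ring
    _ ≤ _ := by gcongr

theorem ofReal_le_eLpNorm_of_le_norm_on_Icc {E : Type*} [NormedAddCommGroup E] {v : ℝ → E}
    {c x : ℝ} {q : ℝ≥0∞} (hq : q ≠ 0) (hv : ∀ s ∈ Set.Icc (x - 1) x, c ≤ ‖v s‖) :
    ENNReal.ofReal c ≤ eLpNorm v q volume := by
  rcases le_total c 0 with hc | hc
  · simp [ENNReal.ofReal_of_nonpos hc]
  have h1 : eLpNorm (fun _ : ℝ => c) q (volume.restrict (Set.Icc (x - 1) x)) =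
      ENNReal.ofReal c := by
    have hne : volume.restrict (Set.Icc (x - 1) x) ≠ 0 := by
      simp [Measure.restrict_eq_zero]
    rw [eLpNorm_const _ hq hne]
    simp [Real.enorm_of_nonneg hc]
  rw [← h1]
  refine le_trans (eLpNorm_mono_ae ?_) (eLpNorm_mono_measure v Measure.restrict_le_self)
  filter_upwards [ae_restrict_mem measurableSet_Icc] with s hs
  rw [Real.norm_of_nonneg hc]
  exact hv s hs

/-- An `L^p → L^q` multiplier bound on `Re = ω` controls the semigroup along smooth orbits. -/
theorem IsExpBoundedSemigroup.exists_norm_apply_le_of_contDiff {X : Type*} [NormedAddCommGroup X]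
    [NormedSpace ℂ X] [CompleteSpace X] {T : ℝ → (X →L[ℂ] X)} {M₀ ω₀ : ℝ}
    (hT : IsExpBoundedSemigroup T M₀ ω₀) (hM₀ : 0 < M₀) {P : X →L[ℂ] X}
    (hP : ∀ t, 0 ≤ t → Commute (T t) P)
    {Q : ℂ → X →L[ℂ] X} {w C₀ b : ℝ} (hQ : DifferentiableOn ℂ Q {l | w < l.re})
    (hQC : ∀ l : ℂ, w < l.re → ‖Q l‖ ≤ C₀)
    (hQS : ∀ l : ℂ, b < l.re → ∀ x : X,
      Q l x = ∫ t in Set.Ioi (0 : ℝ), Complex.exp (-(l * t)) • T t (P x))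
    {ω : ℝ} (hω : w < ω) {p q : ℝ≥0∞} (hp : 1 ≤ p) (hq : 1 ≤ q) {C : ℝ} (hC : 0 ≤ C)
    (hbound : ∀ f : 𝓢(ℝ, X),
      eLpNorm (𝓕⁻ fun ξ : ℝ => Q (ω + ξ * Complex.I) (𝓕 (⇑f) ξ)) q volume ≤
        ENNReal.ofReal C * eLpNorm (⇑f) p volume) :
    ∃ K : ℝ, 0 ≤ K ∧ ∀ (y : X) (W : ℝ → X), ContDiff ℝ ((⊤ : ℕ∞) : WithTop ℕ∞) W →
      (∀ s ∈ Set.Icc (0 : ℝ) 3, W s = T (2 * Real.pi * s) y) →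
      ∀ x : ℝ, 4 ≤ x → ‖T (2 * Real.pi * x) (P y)‖ ≤
        K * Real.exp (2 * Real.pi * ω * x) * ‖y‖ := by
  have hpi := Real.pi_pos
  let β : ContDiffBump (2 : ℝ) := ⟨1 / 2, 1, by norm_num, by norm_num⟩
  set χ : ℝ → ℝ := β.normed volume with hχ
  have hχd : ContDiff ℝ ((⊤ : ℕ∞) : WithTop ℕ∞) χ := β.contDiff_normed
  have hχc : HasCompactSupport χ := β.hasCompactSupport_normed
  have hχ1 : ∫ s, χ s = 1 := β.integral_normed
  have hχsupp : ∀ s, s ∉ Set.Ioo (1 : ℝ) 3 → χ s = 0 := by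
    intro s hs
    rw [← Function.notMem_support, hχ, β.support_normed_eq, Real.ball_eq_Ioo]
    norm_num [β]
    intro h
    by_contra! h3
    exact hs ⟨h, h3⟩
  obtain ⟨B, hB⟩ := hχd.continuous.bounded_above_of_compact_support hχc
  have hB0 : 0 ≤ B := (norm_nonneg _).trans (hB 0)
  have hTle : ∀ r t : ℝ, 0 ≤ t → t ≤ r → ‖T t‖ ≤ M₀ * Real.exp (|ω₀| * r) := by
    intro r t ht htr
    refine (hT.norm_le t ht).trans ?_
    gcongr
    exact le_abs_self ω₀
  set L : ℝ := Real.exp (2 * Real.pi * |ω| * 3) * (B * (M₀ * Real.exp (|ω₀| * (2 * Real.pi * 3))))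
    with hL
  set L' : ℝ := M₀ * Real.exp (|ω₀| * (2 * Real.pi)) * Real.exp (2 * Real.pi * |ω|) with hL'
  refine ⟨L' * (C * (2 * L)), by positivity, fun y W hW hWT x hx => ?_⟩
  set G : ℝ → X := fun s => χ s • W s with hG
  have hGd : ContDiff ℝ ((⊤ : ℕ∞) : WithTop ℕ∞) G := hχd.smul hW
  have hGc : HasCompactSupport G := hχc.smul_right
  have hfd : ∀ c : ℝ, ContDiff ℝ ((⊤ : ℕ∞) : WithTop ℕ∞)
      fun s : ℝ => Real.exp (-(2 * Real.pi * c * s)) • G s := fun c => by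
    have hc : ContDiff ℝ ((⊤ : ℕ∞) : WithTop ℕ∞)
        fun s : ℝ => Real.exp (-(2 * Real.pi * c * s)) := by fun_prop
    exact hc.smul hGd
  have hfc : ∀ c : ℝ, HasCompactSupport fun s : ℝ => Real.exp (-(2 * Real.pi * c * s)) • G s :=
    fun c => hGc.smul_left
  let f : ℝ → 𝓢(ℝ, X) := fun c => (hfc c).toSchwartzMap (hfd c)
  have hf : ∀ c s, f c s = Real.exp (-(2 * Real.pi * c * s)) • G s := fun c s => rfl
  set a : ℝ := max (max ω₀ b) ω + 1 with ha
  have haω₀ : max ω₀ b < a := (le_max_left _ _).trans_lt (lt_add_one _)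
  have hωa : ω ≤ a := (le_max_right _ _).trans (lt_add_one _).le
  set S : ℝ → X →L[ℂ] X := fun t => (T t).comp P with hS
  have hScont : ∀ x, ContinuousOn (fun t => S t x) (Set.Ici 0) := fun x => hT.continuousOn (P x)
  have hSle : ∀ t, 0 ≤ t → ‖S t‖ ≤ M₀ * ‖P‖ * Real.exp (max ω₀ b * t) := by
    intro t ht
    refine (ContinuousLinearMap.opNorm_comp_le _ _).trans ?_
    rw [mul_right_comm]
    gcongr
    refine (hT.norm_le t ht).trans ?_
    gcongr
    exact le_max_left _ _
  have hconv : ∀ z : ℝ, 3 ≤ z → 𝓕⁻ (fun ξ : ℝ => Q (a + ξ * Complex.I) (𝓕 (⇑(f a)) ξ)) z =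
      (2 * Real.pi * Real.exp (-(2 * Real.pi * a * z))) • T (2 * Real.pi * z) (P y) := by
    intro z hz
    rw [fourierInv_laplace_apply_fourier haω₀ hScont hSle
      (fun l hl => hQS l ((le_max_right _ _).trans_lt hl))]
    have hχz : ∀ t, t ∉ Set.Ioi (0 : ℝ) → χ (z - t) = 0 := fun t ht => by
      refine hχsupp _ fun h => ht ?_
      have := h.2
      exact Set.mem_Ioi.2 (by linarith)
    calc _ = ∫ t in Set.Ioi (0 : ℝ), χ (z - t) •
          ((2 * Real.pi * Real.exp (-(2 * Real.pi * a * z))) • T (2 * Real.pi * z) (P y)) := by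
          refine setIntegral_congr_fun measurableSet_Ioi fun t ht => ?_
          have ht' : (0 : ℝ) < t := ht
          simp only [hf, hG]
          by_cases hzt : z - t ∈ Set.Ioo (1 : ℝ) 3
          · have h0 : 0 ≤ z - t := by linarith [hzt.1]
            have h1 : T (2 * Real.pi * z) =
                (T (2 * Real.pi * t)).comp (T (2 * Real.pi * (z - t))) := by
              rw [← hT.map_add _ _ (by positivity) (by positivity)]
              congr 1
              ring
            have h2 : T (2 * Real.pi * (z - t)) (P y) = P (T (2 * Real.pi * (z - t)) y) :=
              congrArg (fun A => A y) (hP (2 * Real.pi * (z - t)) (by positivity)).eq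
            rw [hWT _ ⟨h0, hzt.2.le⟩, h1]
            simp only [hS, ContinuousLinearMap.comp_apply, ContinuousLinearMap.map_smul_of_tower,
              smul_smul, h2]
            congr 1
            rw [show -(2 * Real.pi * a * z) =
                -(2 * Real.pi * a * t) + -(2 * Real.pi * a * (z - t)) by
              ring, Real.exp_add]
            ring
          · simp [hχsupp _ hzt]
      _ = _ := by
          rw [integral_smul_const, setIntegral_eq_integral_of_forall_compl_eq_zero hχz,
            integral_sub_left_eq_self χ volume z, hχ1, one_smul]
  set v : ℝ → X := 𝓕⁻ fun ξ : ℝ => Q (ω + ξ * Complex.I) (𝓕 (⇑(f ω)) ξ) with hv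
  have hvz : ∀ z : ℝ, 3 ≤ z →
      Real.exp (2 * Real.pi * ω * z) • v z = (2 * Real.pi) • T (2 * Real.pi * z) (P y) := by
    intro z hz
    rw [hv, exp_smul_fourierInv_apply_fourier_eq hQ hQC (hGd.of_le (by simp)) hGc hω hωa (hf ω)
      (hf a) z, hconv z hz, smul_smul]
    congr 1
    rw [mul_left_comm, ← Real.exp_add, add_neg_cancel, Real.exp_zero, mul_one]
  have hfle : eLpNorm (⇑(f ω)) p volume ≤ ENNReal.ofReal (2 * (L * ‖y‖)) := by
    have hsub : (⇑(f ω)).support ⊆ Set.Icc (1 : ℝ) 3 := by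
      intro s hs
      by_contra hs'
      exact hs (by simp [hf, hG, hχsupp s fun h => hs' (Set.Ioo_subset_Icc_self h)])
    rw [← eLpNorm_restrict_eq_of_support_subset hsub]
    have hle : ∀ᵐ s ∂(volume.restrict (Set.Icc (1 : ℝ) 3)), ‖f ω s‖ ≤ L * ‖y‖ := by
      filter_upwards [ae_restrict_mem measurableSet_Icc] with s hs
      have hs0 : 0 ≤ s := by linarith [hs.1]
      simp only [hf, hG]
      rw [norm_smul, norm_smul, hWT s ⟨hs0, hs.2⟩, Real.norm_of_nonneg (Real.exp_pos _).le]
      have h1 : -(2 * Real.pi * ω * s) ≤ 2 * Real.pi * |ω| * 3 := by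
        calc -(2 * Real.pi * ω * s) = 2 * Real.pi * (-ω) * s := by ring
          _ ≤ 2 * Real.pi * |ω| * 3 := by
            gcongr
            exacts [neg_le_abs ω, hs.2]
      have h2 : ‖T (2 * Real.pi * s) y‖ ≤ M₀ * Real.exp (|ω₀| * (2 * Real.pi * 3)) * ‖y‖ := by
        refine (T _).le_of_opNorm_le (hTle _ _ (by positivity) ?_) y
        gcongr
        exact hs.2
      calc Real.exp (-(2 * Real.pi * ω * s)) * (‖χ s‖ * ‖T (2 * Real.pi * s) y‖)
          ≤ Real.exp (2 * Real.pi * |ω| * 3) *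
            (B * (M₀ * Real.exp (|ω₀| * (2 * Real.pi * 3)) * ‖y‖)) := by
            gcongr
            exact hB s
        _ = L * ‖y‖ := by rw [hL]; ring
    refine (eLpNorm_le_of_ae_bound hle).trans ?_
    rw [ENNReal.ofReal_mul zero_le_two]
    gcongr
    have hp1 : p.toReal⁻¹ ≤ 1 := by
      by_cases hp' : p = ∞
      · simp [hp']
      · refine inv_le_one_of_one_le₀ ?_
        rw [← ENNReal.toReal_one]
        exact ENNReal.toReal_mono hp' hp
    simp only [MeasurableSet.univ, Measure.restrict_apply, Set.univ_inter, Real.volume_Icc]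
    norm_num
    exact (ENNReal.rpow_le_rpow_of_exponent_le one_le_two hp1).trans_eq (ENNReal.rpow_one _)
  have hlower : ∀ s ∈ Set.Icc (x - 1) x,
      ‖T (2 * Real.pi * x) (P y)‖ * Real.exp (-(2 * Real.pi * ω * x)) / L' ≤ ‖v s‖ := by
    intro s hs
    have hs3 : 3 ≤ s := by linarith [hs.1]
    have hxs : 0 ≤ x - s := by linarith [hs.2]
    have h1 : T (2 * Real.pi * x) (P y) =
        T (2 * Real.pi * (x - s)) (T (2 * Real.pi * s) (P y)) := by
      change _ = ((T (2 * Real.pi * (x - s))).comp (T (2 * Real.pi * s))) (P y)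
      rw [← hT.map_add _ _ (by positivity) (by positivity)]
      congr 2
      ring
    have h2 : ‖T (2 * Real.pi * x) (P y)‖ ≤
        M₀ * Real.exp (|ω₀| * (2 * Real.pi)) * ‖T (2 * Real.pi * s) (P y)‖ := by
      rw [h1]
      refine (T _).le_of_opNorm_le (hTle _ _ (by positivity) ?_) _
      refine mul_le_of_le_one_right (by positivity) ?_
      linarith [hs.1]
    have h3 : ‖T (2 * Real.pi * s) (P y)‖ ≤ Real.exp (2 * Real.pi * ω * s) * ‖v s‖ := by
      have := congrArg norm (hvz s hs3)
      rw [norm_smul, norm_smul, Real.norm_of_nonneg (Real.exp_pos _).le,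
        Real.norm_of_nonneg (by positivity)] at this
      rw [this]
      exact le_mul_of_one_le_left (norm_nonneg _) (by linarith [Real.pi_gt_three])
    have h4 : Real.exp (2 * Real.pi * ω * s) ≤
        Real.exp (2 * Real.pi * |ω|) * Real.exp (2 * Real.pi * ω * x) := by
      rw [← Real.exp_add, Real.exp_le_exp]
      have h5 : -ω * (x - s) ≤ |ω| * 1 := by
        refine mul_le_mul (neg_le_abs ω) ?_ hxs (abs_nonneg ω)
        linarith [hs.1]
      calc 2 * Real.pi * ω * s = 2 * Real.pi * (-ω * (x - s)) + 2 * Real.pi * ω * x := by ring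
        _ ≤ 2 * Real.pi * (|ω| * 1) + 2 * Real.pi * ω * x := by gcongr
        _ = _ := by ring
    rw [div_le_iff₀ (by positivity), Real.exp_neg, ← div_eq_mul_inv, div_le_iff₀ (Real.exp_pos _)]
    calc ‖T (2 * Real.pi * x) (P y)‖
        ≤ M₀ * Real.exp (|ω₀| * (2 * Real.pi)) * ((Real.exp (2 * Real.pi * |ω|) *
          Real.exp (2 * Real.pi * ω * x)) * ‖v s‖) := by
          refine h2.trans ?_
          gcongr
          refine h3.trans ?_
          gcongr
      _ = ‖v s‖ * L' * Real.exp (2 * Real.pi * ω * x) := by rw [hL']; ring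
  have hfinal := (ofReal_le_eLpNorm_of_le_norm_on_Icc (zero_lt_one.trans_le hq).ne' hlower).trans
    ((hbound (f ω)).trans (mul_le_mul_right hfle _))
  rw [← ENNReal.ofReal_mul hC, ENNReal.ofReal_le_ofReal_iff (by positivity),
    div_le_iff₀ (by positivity), Real.exp_neg, ← div_eq_mul_inv, div_le_iff₀ (Real.exp_pos _)]
    at hfinal
  refine hfinal.trans_eq ?_
  ring

/-- Vectors with smooth orbits are dense (Gårding). -/
theorem IsExpBoundedSemigroup.exists_tendsto_contDiff {X : Type*} [NormedAddCommGroup X]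
    [NormedSpace ℂ X] [CompleteSpace X] {T : ℝ → (X →L[ℂ] X)} {M₀ ω₀ : ℝ}
    (hT : IsExpBoundedSemigroup T M₀ ω₀) (x : X) :
    ∃ (y : ℕ → X) (W : ℕ → ℝ → X), (∀ n, ContDiff ℝ ((⊤ : ℕ∞) : WithTop ℕ∞) (W n)) ∧
      (∀ n s, 0 ≤ s → W n s = T (2 * Real.pi * s) (y n)) ∧
      Filter.Tendsto y Filter.atTop (nhds x) := by
  have hpi := Real.pi_pos
  set h : ℝ → X := fun r => T (2 * Real.pi * max r 0) x with hh
  have hcont : Continuous h := (hT.continuousOn x).comp_continuous (by fun_prop) fun r =>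
    Set.mem_Ici.2 (by positivity)
  set δ : ℕ → ℝ := fun n => 1 / ((n : ℝ) + 1) with hδ
  have hδ0 : ∀ n, 0 < δ n := fun n => by positivity
  have hδt : Filter.Tendsto δ Filter.atTop (nhds 0) := tendsto_one_div_add_atTop_nhds_zero_nat
  let φ : ℕ → ContDiffBump (0 : ℝ) := fun n =>
    ⟨δ n / 2, δ n, half_pos (hδ0 n), half_lt_self (hδ0 n)⟩
  set V : ℕ → ℝ → X := fun n =>
    convolution ((φ n).normed volume) h (ContinuousLinearMap.lsmul ℝ ℝ) volume with hV
  have hVd : ∀ n, ContDiff ℝ ((⊤ : ℕ∞) : WithTop ℕ∞) (V n) := fun n =>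
    (φ n).hasCompactSupport_normed.contDiff_convolution_left _ (φ n).contDiff_normed
      hcont.locallyIntegrable
  have hVz : ∀ n r, V n r = ∫ t : ℝ, (φ n).normed volume t • h (r - t) := fun n r => rfl
  refine ⟨fun n => V n (δ n), fun n s => V n (s + δ n), fun n => (hVd n).comp (by fun_prop),
    fun n s hs => ?_, ?_⟩
  · beta_reduce
    rw [hVz, hVz, ← ContinuousLinearMap.integral_comp_comm]
    · refine integral_congr_ae (Filter.Eventually.of_forall fun t => ?_)
      simp only [ContinuousLinearMap.map_smul_of_tower]
      by_cases ht : t ∈ Function.support ((φ n).normed volume)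
      · rw [(φ n).support_normed_eq, Real.ball_eq_Ioo] at ht
        have ht' : 0 ≤ δ n - t := by
          have : t < 0 + δ n := ht.2
          linarith
        congr 1
        simp only [hh]
        rw [max_eq_left ht', max_eq_left (by linarith)]
        change _ = ((T (2 * Real.pi * s)).comp (T (2 * Real.pi * (δ n - t)))) x
        rw [← hT.map_add _ _ (by positivity) (by positivity)]
        congr 2
        ring
      · rw [Function.notMem_support.1 ht, zero_smul, zero_smul]
    · exact Continuous.integrable_of_hasCompactSupport
        ((φ n).continuous_normed.smul (by fun_prop)) (φ n).hasCompactSupport_normed.smul_right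
  · have h0 : h 0 = x := by simp [hh, hT.map_zero]
    rw [← h0]
    exact ContDiffBump.convolution_tendsto_right (φ := φ) (g := fun _ => h) (k := δ) hδt
      (Filter.Eventually.of_forall fun _ => hcont.aestronglyMeasurable)
      ((hcont.tendsto 0).comp Filter.tendsto_snd) hδt

/-- An `L^p → L^q` multiplier bound on `Re = ω` bounds the semigroup by a multiple of `e^{ωt}`. -/
theorem IsExpBoundedSemigroup.exists_norm_comp_le {X : Type*} [NormedAddCommGroup X]
    [NormedSpace ℂ X] [CompleteSpace X] {T : ℝ → (X →L[ℂ] X)} {M₀ ω₀ : ℝ}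
    (hT : IsExpBoundedSemigroup T M₀ ω₀) (hM₀ : 0 < M₀) {P : X →L[ℂ] X}
    (hP : ∀ t, 0 ≤ t → Commute (T t) P)
    {Q : ℂ → X →L[ℂ] X} {w C₀ b : ℝ} (hQ : DifferentiableOn ℂ Q {l | w < l.re})
    (hQC : ∀ l : ℂ, w < l.re → ‖Q l‖ ≤ C₀)
    (hQS : ∀ l : ℂ, b < l.re → ∀ x : X,
      Q l x = ∫ t in Set.Ioi (0 : ℝ), Complex.exp (-(l * t)) • T t (P x))
    {ω : ℝ} (hω : w < ω) {p q : ℝ≥0∞} (hp : 1 ≤ p) (hq : 1 ≤ q) {C : ℝ} (hC : 0 ≤ C)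
    (hbound : ∀ f : 𝓢(ℝ, X),
      eLpNorm (𝓕⁻ fun ξ : ℝ => Q (ω + ξ * Complex.I) (𝓕 (⇑f) ξ)) q volume ≤
        ENNReal.ofReal C * eLpNorm (⇑f) p volume) :
    ∃ K : ℝ, 0 ≤ K ∧ ∀ t, 0 ≤ t → ‖(T t).comp P‖ ≤ K * Real.exp (ω * t) := by
  have hpi := Real.pi_pos
  obtain ⟨K, hK, hKW⟩ := hT.exists_norm_apply_le_of_contDiff hM₀ hP hQ hQC hQS hω hp hq hC hbound
  have hlarge : ∀ t, 8 * Real.pi ≤ t → ‖(T t).comp P‖ ≤ K * Real.exp (ω * t) := by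
    intro t ht
    refine ContinuousLinearMap.opNorm_le_bound _ (by positivity) fun z => ?_
    obtain ⟨y, W, hW, hWT, hy⟩ := hT.exists_tendsto_contDiff z
    refine le_of_tendsto_of_tendsto ((((T t).comp P).continuous.tendsto z).comp hy).norm
      (hy.norm.const_mul _) (Filter.Eventually.of_forall fun n => ?_)
    have hx : 4 ≤ t / (2 * Real.pi) := by
      rw [le_div_iff₀ (by positivity)]
      linarith
    have := hKW (y n) (W n) (hW n) (fun s hs => hWT n s hs.1) _ hx
    rwa [mul_div_cancel₀ _ (by positivity),
      mul_right_comm (2 * Real.pi), mul_div_cancel₀ _ (by positivity), mul_comm t] at this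
  have hsmall : ∀ t, 0 ≤ t → t ≤ 8 * Real.pi → ‖(T t).comp P‖ ≤
      M₀ * Real.exp (|ω₀| * (8 * Real.pi)) * ‖P‖ * Real.exp (|ω| * (8 * Real.pi)) *
        Real.exp (ω * t) := by
    intro t ht ht'
    have h1 : 1 ≤ Real.exp (|ω| * (8 * Real.pi)) * Real.exp (ω * t) := by
      rw [← Real.exp_add, Real.one_le_exp_iff]
      have : -ω * t ≤ |ω| * (8 * Real.pi) := mul_le_mul (neg_le_abs ω) ht' ht (abs_nonneg ω)
      linarith
    have h2 : ‖T t‖ ≤ M₀ * Real.exp (|ω₀| * (8 * Real.pi)) := by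
      refine (hT.norm_le t ht).trans ?_
      gcongr
      exact le_abs_self ω₀
    calc ‖(T t).comp P‖ ≤ ‖T t‖ * ‖P‖ := ContinuousLinearMap.opNorm_comp_le _ _
      _ ≤ M₀ * Real.exp (|ω₀| * (8 * Real.pi)) * ‖P‖ := by gcongr
      _ ≤ M₀ * Real.exp (|ω₀| * (8 * Real.pi)) * ‖P‖ *
          (Real.exp (|ω| * (8 * Real.pi)) * Real.exp (ω * t)) :=
          le_mul_of_one_le_right (by positivity) h1
      _ = _ := by ring
  refine ⟨max K (M₀ * Real.exp (|ω₀| * (8 * Real.pi)) * ‖P‖ * Real.exp (|ω| * (8 * Real.pi))),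
    le_max_of_le_left hK, fun t ht => ?_⟩
  rcases le_total t (8 * Real.pi) with h | h
  · refine (hsmall t ht h).trans ?_
    gcongr
    exact le_max_right _ _
  · refine (hlarge t h).trans ?_
    gcongr
    exact le_max_left _ _

/-- Fourier-multiplier characterization of exponential decay for orbits with
initial data in `D(A^m)`: given a `C₀`-semigroup with uniformly bounded resolvent on
`{Re λ ≥ ω'}`, the multiplier boundedness of `ξ ↦ R(ω+iξ) R(μ)^m` (for each `ω > ω'`,
for some `p,q ∈ [1,∞]`) is equivalent to `‖T(t) R(μ)^m‖ ≤ C e^{ωt}` for each `ω > ω'`;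
moreover in that case the multiplier bound holds for all `1 ≤ p ≤ q ≤ ∞`. -/
theorem exp_decay_fourier_multiplier_characterization
    {X : Type*} [NormedAddCommGroup X] [NormedSpace ℂ X] [CompleteSpace X]
    (T : ℝ → (X →L[ℂ] X)) (M₀ ω₀ : ℝ) (hM₀ : 1 ≤ M₀)
    (hT0 : T 0 = 1)
    (hTsemi : ∀ s t : ℝ, 0 ≤ s → 0 ≤ t → T (s + t) = (T s).comp (T t))
    (hTcont : ∀ x : X, ContinuousOn (fun t => T t x) (Set.Ici 0))
    (hTbdd : ∀ t : ℝ, 0 ≤ t → ‖T t‖ ≤ M₀ * Real.exp (ω₀ * t))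
    (ω' : ℝ) (R : ℂ → (X →L[ℂ] X))
    (hres : ∀ l μ : ℂ, (ω' ≤ l.re ∨ ω₀ < l.re) → (ω' ≤ μ.re ∨ ω₀ < μ.re) →
      R l - R μ = (μ - l) • ((R l).comp (R μ)))
    (hlap : ∀ l : ℂ, max ω₀ ω' < l.re → ∀ x : X,
      R l x = ∫ t in Set.Ioi (0:ℝ), Complex.exp (-(l * t)) • T t x)
    (C₀ : ℝ) (hbdd : ∀ l : ℂ, ω' ≤ l.re → ‖R l‖ ≤ C₀)
    (m : ℕ) (μ : ℂ) (hμ : max ω₀ ω' < μ.re) :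
    ((∀ ω : ℝ, ω' < ω → ∃ p q : ℝ≥0∞, 1 ≤ p ∧ 1 ≤ q ∧ ∃ C : ℝ, 0 ≤ C ∧
        ∀ f : SchwartzMap ℝ X,
          eLpNorm (𝓕⁻ fun ξ : ℝ =>
              ((R (↑ω + ↑ξ * Complex.I)).comp ((R μ) ^ m)) (𝓕 (⇑f) ξ)) q volume ≤
            ENNReal.ofReal C * eLpNorm (⇑f) p volume) ↔
      (∀ ω : ℝ, ω' < ω → ∃ C : ℝ, 0 ≤ C ∧ ∀ t : ℝ, 0 ≤ t →
        ‖(T t).comp ((R μ) ^ m)‖ ≤ C * Real.exp (ω * t))) ∧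
    ((∀ ω : ℝ, ω' < ω → ∃ C : ℝ, 0 ≤ C ∧ ∀ t : ℝ, 0 ≤ t →
        ‖(T t).comp ((R μ) ^ m)‖ ≤ C * Real.exp (ω * t)) →
      ∀ ω : ℝ, ω' < ω → ∀ p q : ℝ≥0∞, 1 ≤ p → p ≤ q → ∃ C : ℝ, 0 ≤ C ∧
        ∀ f : SchwartzMap ℝ X,
          eLpNorm (𝓕⁻ fun ξ : ℝ =>
              ((R (↑ω + ↑ξ * Complex.I)).comp ((R μ) ^ m)) (𝓕 (⇑f) ξ)) q volume ≤
            ENNReal.ofReal C * eLpNorm (⇑f) p volume) := by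
  have hT : IsExpBoundedSemigroup T M₀ ω₀ := ⟨hT0, hTsemi, hTcont, hTbdd⟩
  set P : X →L[ℂ] X := R μ ^ m with hPdef
  have hP : ∀ t, 0 ≤ t → Commute (T t) P := fun t ht =>
    (hT.comp_eq_comp_of_laplace ((le_max_left _ _).trans_lt hμ) (hlap μ hμ) ht).pow_right m
  have hRd : DifferentiableOn ℂ R {l | ω' < l.re} :=
    differentiableOn_of_resolvent_identity (fun l μ hl hμ => hres l μ (.inl hl) (.inl hμ)) hbdd
  set Q : ℂ → X →L[ℂ] X := fun l => (R l).comp P with hQdef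
  have hQ : DifferentiableOn ℂ Q {l | ω' < l.re} := hRd.clm_comp (differentiableOn_const P)
  have hQC : ∀ l : ℂ, ω' < l.re → ‖Q l‖ ≤ C₀ * ‖P‖ := fun l hl => by
    refine (ContinuousLinearMap.opNorm_comp_le _ _).trans ?_
    gcongr
    exact hbdd l hl.le
  have hQS : ∀ l : ℂ, max ω₀ ω' < l.re → ∀ x : X,
      Q l x = ∫ t in Set.Ioi (0 : ℝ), Complex.exp (-(l * t)) • T t (P x) :=
    fun l hl x => hlap l hl (P x)
  have hmult : (∀ ω : ℝ, ω' < ω → ∃ C : ℝ, 0 ≤ C ∧ ∀ t : ℝ, 0 ≤ t →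
        ‖(T t).comp P‖ ≤ C * Real.exp (ω * t)) →
      ∀ ω : ℝ, ω' < ω → ∀ p q : ℝ≥0∞, 1 ≤ p → p ≤ q → ∃ C : ℝ, 0 ≤ C ∧
        ∀ f : SchwartzMap ℝ X,
          eLpNorm (𝓕⁻ fun ξ : ℝ => Q (ω + ξ * Complex.I) (𝓕 (⇑f) ξ)) q volume ≤
            ENNReal.ofReal C * eLpNorm (⇑f) p volume := by
    intro h ω hω p q hp hpq
    obtain ⟨ω₁, hω₁, hω₁ω⟩ := exists_between hω
    obtain ⟨C, -, hCT⟩ := h ω₁ hω₁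
    refine exists_eLpNorm_fourierInv_laplace_le (S := fun t => (T t).comp P) hω₁ω
      (fun x => hTcont (P x)) hCT (fun l hl x => ?_) hp hpq
    refine eq_integral_exp_neg_mul_smul_of_differentiableOn (Q := fun l => Q l x)
      (g := fun t => T t (P x)) (C := C * ‖x‖) (w := ω₁) (b := max ω₀ ω') ?_ (hTcont (P x))
      (fun t ht => ?_) (fun l hl => hQS l hl x) hl
    · exact (hQ.mono fun l hl => hω₁.trans hl).clm_apply (differentiableOn_const x)
    · rw [mul_right_comm]
      exact ((T t).comp P).le_of_opNorm_le (hCT t ht) x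
  refine ⟨⟨fun h ω hω => ?_, fun h ω hω => ?_⟩, hmult⟩
  · obtain ⟨p, q, hp, hq, C, hC, hbound⟩ := h ω hω
    exact hT.exists_norm_comp_le (zero_lt_one.trans_le hM₀) hP hQ hQC hQS hω hp hq hC hbound
  · exact ⟨1, 1, le_rfl, le_rfl, hmult h ω hω 1 1 le_rfl le_rfl⟩
end

section
/- Let X be a complex Banach space and T a C₀-semigroup on X with ‖T(t)‖ ≤ M₀ e^{ω₀ t}. Let R : D → L(X), where D := {Re λ ≥ 0} ∪ {Re λ > ω₀}, satisfy the resolvent identity on D and the Laplace-transform identity R(λ)x = ∫₀^∞ e^{−λt} T(t)x dt for Re λ > max(ω₀, 0), and assume sup_{Re λ ≥ 0} ‖R(λ)‖ < ∞. Then for every μ ∈ ℂ with Re μ > max(ω₀, 0) there exist C ≥ 0 and ω < 0 such that ‖T(t)∘R(μ)‖ ≤ C e^{ω t} for all t ≥ 0. (This is the case p = 1 of the paper's Fourier-type exponential decay theorem: on an arbitrary Banach space, uniform boundedness of the resolvent on the closed right half-plane implies exponential decay of all classical solutions, i.e. of orbits with initial data in D(A), the graph norm of D(A) being realized by composition with R(μ).)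 -/
open MeasureTheory

section
open Set Filter Topology

theorem integrable_vertical_of_norm_le {X : Type*} [NormedAddCommGroup X] {F : ℂ → X}
    {b a K : ℝ} (hab : a ∈ Icc 0 b)
    (hc : ContinuousOn F (Icc 0 b ×ℂ univ))
    (hK : ∀ z ∈ Icc 0 b ×ℂ univ, ‖F z‖ ≤ K * (1 + |z.im|) ^ (-2 : ℝ)) :
    Integrable fun y : ℝ => F (a + y * Complex.I) := by
  have hmem : ∀ y : ℝ, (a + y * Complex.I : ℂ) ∈ Icc 0 b ×ℂ univ := fun y => by
    simpa [Complex.mem_reProdIm] using hab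
  have hi : Integrable fun y : ℝ => K * (1 + ‖y‖) ^ (-2 : ℝ) :=
    (integrable_one_add_norm (by norm_num)).const_mul K
  refine hi.mono' (Continuous.aestronglyMeasurable ?_) (ae_of_all _ fun y => ?_)
  · exact hc.comp_continuous (by fun_prop) hmem
  · simpa using hK _ (hmem y)

variable {X : Type*} [NormedAddCommGroup X] [NormedSpace ℂ X]

/-- Integrals over vertical lines in a strip agree for functions with quadratic decay. -/
theorem integral_vertical_eq_of_norm_le {F : ℂ → X} {b K : ℝ} (hb : 0 ≤ b)
    (hc : ContinuousOn F (Icc 0 b ×ℂ univ)) (hd : DifferentiableOn ℂ F (Ioo 0 b ×ℂ univ))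
    (hK : ∀ z ∈ Icc 0 b ×ℂ univ, ‖F z‖ ≤ K * (1 + |z.im|) ^ (-2 : ℝ)) :
    ∫ y : ℝ, F (b + y * Complex.I) = ∫ y : ℝ, F (y * Complex.I) := by
  have hlim : ∀ a ∈ Icc 0 b, Tendsto (fun N : ℝ => ∫ y in (-N)..N, F (a + y * Complex.I)) atTop
      (𝓝 (∫ y : ℝ, F (a + y * Complex.I))) := fun a ha =>
    intervalIntegral_tendsto_integral (integrable_vertical_of_norm_le ha hc hK)
      tendsto_neg_atTop_atBot tendsto_id
  have h0 := hlim 0 ⟨le_rfl, hb⟩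
  simp only [Complex.ofReal_zero, zero_add] at h0
  have hhor : ∀ s : ℝ, |s| = 1 →
      Tendsto (fun N : ℝ => ∫ x in (0 : ℝ)..b, F (x + (s * N : ℝ) * Complex.I)) atTop (𝓝 0) := by
    intro s hs
    have hdec : Tendsto (fun N : ℝ => K * (1 + N) ^ (-2 : ℝ) * |b - 0|) atTop (𝓝 0) := by
      have : Tendsto (fun N : ℝ => (1 + N) ^ (-2 : ℝ)) atTop (𝓝 0) :=
        (tendsto_rpow_neg_atTop (by norm_num : (0 : ℝ) < 2)).comp
          (tendsto_atTop_add_const_left _ _ tendsto_id)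
      simpa using (this.const_mul K).mul_const |b - 0|
    refine squeeze_zero_norm' ?_ hdec
    filter_upwards [eventually_ge_atTop 0] with N hN
    refine intervalIntegral.norm_integral_le_of_norm_le_const fun x hx => ?_
    rw [uIoc_of_le hb] at hx
    have := hK (x + (s * N : ℝ) * Complex.I)
      (by simpa [Complex.mem_reProdIm] using ⟨hx.1.le, hx.2⟩)
    simpa [abs_mul, hs, abs_of_nonneg hN] using this
  have hrect : ∀ N : ℝ, 0 ≤ N →
      (∫ y in (-N)..N, F (b + y * Complex.I)) - (∫ y in (-N)..N, F (y * Complex.I)) =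
        Complex.I • ((∫ x in (0 : ℝ)..b, F (x + ((-1) * N : ℝ) * Complex.I))
          - ∫ x in (0 : ℝ)..b, F (x + (1 * N : ℝ) * Complex.I)) := by
    intro N hN
    have h := Complex.integral_boundary_rect_eq_zero_of_continuousOn_of_differentiableOn F
      (⟨0, -N⟩ : ℂ) ⟨b, N⟩
      (hc.mono fun z hz => ⟨by simpa [uIcc_of_le hb] using hz.1, mem_univ _⟩)
      (hd.mono fun z hz => ⟨by simpa [hb] using hz.1, mem_univ _⟩)
    simp only [Complex.ofReal_zero, zero_add] at h
    rw [neg_one_mul, one_mul]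
    set A := ∫ x in (0 : ℝ)..b, F (x + (-N : ℝ) * Complex.I)
    set B := ∫ x in (0 : ℝ)..b, F (x + N * Complex.I)
    set C := ∫ y in (-N)..N, F (b + y * Complex.I)
    set D := ∫ y in (-N)..N, F (y * Complex.I)
    have h2 : A - B + Complex.I • (C - D) = 0 := by rw [smul_sub, ← h]; abel
    rw [eq_neg_of_add_eq_zero_left h2, smul_neg, smul_smul, Complex.I_mul_I, neg_smul, one_smul,
      neg_neg]
  have h1 := ((hhor (-1) (by simp)).sub (hhor 1 (by simp))).const_smul Complex.I
  rw [sub_zero, smul_zero] at h1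
  refine sub_eq_zero.1 (tendsto_nhds_unique ((hlim b ⟨hb, le_rfl⟩).sub h0) (h1.congr' ?_))
  filter_upwards [eventually_ge_atTop 0] with N hN
  exact (hrect N hN).symm

/-- Inversion of the two-sided Laplace transform along a vertical line. -/
theorem integral_exp_smul_laplace_eq [CompleteSpace X] {f : ℝ → X} {G : ℂ → X} {b t : ℝ}
    (hf : Integrable fun s : ℝ => Complex.exp (-(b * s)) • f s)
    (hG : ∀ y : ℝ, ∫ s : ℝ, Complex.exp (-((b + y * Complex.I) * s)) • f s
      = G (b + y * Complex.I))
    (hGi : Integrable fun y : ℝ => G (b + y * Complex.I)) (ht : ContinuousAt f t) :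
    ∫ y : ℝ, Complex.exp ((b + y * Complex.I) * t) • G (b + y * Complex.I)
      = (2 * Real.pi) • f t := by
  have hpi : (2 * Real.pi) ≠ 0 := by positivity
  have hFT : FourierTransform.fourier (fun s : ℝ => Complex.exp (-(b * s)) • f s)
      = fun ξ : ℝ => G (b + (2 * Real.pi * ξ : ℝ) * Complex.I) := by
    ext ξ
    rw [Real.fourier_real_eq_integral_exp_smul, ← hG]
    refine integral_congr_ae (ae_of_all _ fun s => ?_)
    simp only [smul_smul, ← Complex.exp_add]
    congr 2
    push_cast
    ring
  have hFi : Integrable (FourierTransform.fourier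
      (fun s : ℝ => Complex.exp (-(b * s)) • f s)) := by
    rw [hFT]
    exact hGi.comp_mul_left' hpi
  have hinv := hf.fourierInv_fourier_eq hFi (v := t)
    ((by fun_prop : ContinuousAt (fun s : ℝ => Complex.exp (-(b * s))) t).smul ht)
  rw [hFT, Real.fourierInv_eq'] at hinv
  have hscale := Measure.integral_comp_mul_left
    (fun y : ℝ => Complex.exp (y * t * Complex.I) • G (b + y * Complex.I)) (2 * Real.pi)
  have h1 : ∫ y : ℝ, Complex.exp (y * t * Complex.I) • G (b + y * Complex.I)
      = (2 * Real.pi) • (Complex.exp (-(b * t)) • f t) := by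
    rw [← hinv, eq_comm]
    have h2 : (∫ v : ℝ, Complex.exp (((2 * Real.pi * inner ℝ v t : ℝ) : ℂ) * Complex.I) •
        G (b + (2 * Real.pi * v : ℝ) * Complex.I)) = |(2 * Real.pi)⁻¹| •
        ∫ y : ℝ, Complex.exp (y * t * Complex.I) • G (b + y * Complex.I) := by
      rw [← hscale]
      refine integral_congr_ae (ae_of_all _ fun s => ?_)
      simp only [RCLike.inner_apply, conj_trivial]
      congr 3
      push_cast
      ring
    rw [h2, abs_of_pos (by positivity), smul_smul, mul_inv_cancel₀ hpi, one_smul]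
  calc ∫ y : ℝ, Complex.exp ((b + y * Complex.I) * t) • G (b + y * Complex.I)
      = ∫ y : ℝ, Complex.exp (b * t) • (Complex.exp (y * t * Complex.I)
          • G (b + y * Complex.I)) := by
        refine integral_congr_ae (ae_of_all _ fun s => ?_)
        simp only [smul_smul, ← Complex.exp_add]
        congr 2
        ring
    _ = (2 * Real.pi) • f t := by
        rw [integral_smul, h1, smul_comm, smul_smul, ← Complex.exp_add, add_neg_cancel,
          Complex.exp_zero, one_smul]

variable {T : ℝ → (X →L[ℂ] X)} {R : ℂ → (X →L[ℂ] X)} {M w : ℝ}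

theorem norm_exp_smul_orbit_le (hTbdd : ∀ t : ℝ, 0 ≤ t → ‖T t‖ ≤ M * Real.exp (w * t))
    (l : ℂ) (y : X) {s : ℝ} (hs : 0 ≤ s) :
    ‖Complex.exp (-(l * s)) • T s y‖ ≤ M * ‖y‖ * Real.exp ((w - l.re) * s) := by
  rw [norm_smul, Complex.norm_exp]
  have h1 : (-(l * s)).re = -(l.re * s) := by simp
  have h2 := (T s).le_of_opNorm_le (hTbdd s hs) y
  calc Real.exp (-(l * s)).re * ‖T s y‖
      ≤ Real.exp (-(l.re * s)) * (M * Real.exp (w * s) * ‖y‖) := by rw [h1]; gcongr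
    _ = M * ‖y‖ * (Real.exp (w * s) * Real.exp (-(l.re * s))) := by ring
    _ = _ := by rw [← Real.exp_add]; ring_nf

theorem integrableOn_exp_smul_orbit (hTcont : ∀ x : X, ContinuousOn (fun t => T t x) (Ici 0))
    (hTbdd : ∀ t : ℝ, 0 ≤ t → ‖T t‖ ≤ M * Real.exp (w * t)) {l : ℂ} (hl : w < l.re) (y : X) :
    IntegrableOn (fun s : ℝ => Complex.exp (-(l * s)) • T s y) (Ioi 0) := by
  have hi : IntegrableOn (fun s : ℝ => M * ‖y‖ * Real.exp ((w - l.re) * s)) (Ioi 0) :=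
    (integrableOn_exp_mul_Ioi (by linarith) 0).const_mul _
  refine hi.mono' (ContinuousOn.aestronglyMeasurable ?_ measurableSet_Ioi) ?_
  · exact (by fun_prop : Continuous fun s : ℝ => Complex.exp (-(l * s))).continuousOn.smul
      ((hTcont y).mono Ioi_subset_Ici_self)
  · filter_upwards [ae_restrict_mem measurableSet_Ioi] with s hs
    exact norm_exp_smul_orbit_le hTbdd l y (le_of_lt hs)

theorem norm_laplace_le (hM : 0 ≤ M) (hTbdd : ∀ t : ℝ, 0 ≤ t → ‖T t‖ ≤ M * Real.exp (w * t))
    (hlap : ∀ l : ℂ, w < l.re → ∀ x : X,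
      R l x = ∫ t in Ioi (0 : ℝ), Complex.exp (-(l * t)) • T t x)
    {l : ℂ} (hl : w < l.re) : ‖R l‖ ≤ M / (l.re - w) := by
  have hpos : 0 < l.re - w := by linarith
  refine ContinuousLinearMap.opNorm_le_bound _ (by positivity) fun x => ?_
  rw [hlap l hl]
  have hi : IntegrableOn (fun s : ℝ => M * ‖x‖ * Real.exp ((w - l.re) * s)) (Ioi 0) :=
    (integrableOn_exp_mul_Ioi (by linarith) 0).const_mul _
  refine (norm_integral_le_of_norm_le hi ?_).trans_eq ?_
  · filter_upwards [ae_restrict_mem measurableSet_Ioi] with s hs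
    exact norm_exp_smul_orbit_le hTbdd l x (le_of_lt hs)
  · rw [integral_const_mul, integral_exp_mul_Ioi (by linarith)]
    have : w - l.re ≠ 0 := by linarith
    simp only [mul_zero, Real.exp_zero]
    field_simp
    ring

/-- The orbit of `R μ (R n x)`, continued to negative times by exponentials so that its two-sided
Laplace transform is `((μ - l) * (n - l))⁻¹ • R l x`. -/
noncomputable def extendedOrbit (T : ℝ → (X →L[ℂ] X)) (R : ℂ → (X →L[ℂ] X)) (μ n : ℂ) (x : X)
    (s : ℝ) : X :=
  if 0 < s then T s (R μ (R n x))
  else (n - μ)⁻¹ • (Complex.exp (μ * s) • R μ x - Complex.exp (n * s) • R n x)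

theorem resolvent_apply_apply {l μ : ℂ} (hlμ : l ≠ μ)
    (h : R l - R μ = (μ - l) • ((R l).comp (R μ))) (x : X) :
    R l (R μ x) = (μ - l)⁻¹ • (R l x - R μ x) := by
  have h1 : R l x - R μ x = (μ - l) • R l (R μ x) := by
    simpa using congrArg (fun S : X →L[ℂ] X => S x) h
  rw [h1, smul_smul, inv_mul_cancel₀ (sub_ne_zero.2 hlμ.symm), one_smul]

theorem laplace_extendedOrbit [CompleteSpace X]
    (hTcont : ∀ x : X, ContinuousOn (fun t => T t x) (Ici 0))
    (hTbdd : ∀ t : ℝ, 0 ≤ t → ‖T t‖ ≤ M * Real.exp (w * t))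
    (hres : ∀ l μ : ℂ, w < l.re → w < μ.re → R l - R μ = (μ - l) • ((R l).comp (R μ)))
    (hlap : ∀ l : ℂ, w < l.re → ∀ x : X,
      R l x = ∫ t in Ioi (0 : ℝ), Complex.exp (-(l * t)) • T t x)
    {l μ n : ℂ} (hl : w < l.re) (hμ : l.re < μ.re) (hn : μ.re < n.re) (x : X) :
    Integrable (fun s : ℝ => Complex.exp (-(l * s)) • extendedOrbit T R μ n x s) ∧
      ∫ s : ℝ, Complex.exp (-(l * s)) • extendedOrbit T R μ n x s
        = ((μ - l) * (n - l))⁻¹ • R l x := by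
  have hpos : EqOn (fun s : ℝ => Complex.exp (-(l * s)) • extendedOrbit T R μ n x s)
      (fun s : ℝ => Complex.exp (-(l * s)) • T s (R μ (R n x))) (Ioi 0) := fun s hs => by
    simp [extendedOrbit, mem_Ioi.1 hs]
  have hneg : EqOn (fun s : ℝ => Complex.exp (-(l * s)) • extendedOrbit T R μ n x s)
      (fun s : ℝ => (n - μ)⁻¹ • (Complex.exp ((μ - l) * s) • R μ x
        - Complex.exp ((n - l) * s) • R n x)) (Iic 0) := fun s hs => by
    have h1 : Complex.exp ((μ - l) * s) = Complex.exp (-(l * s)) * Complex.exp (μ * s) := by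
      rw [← Complex.exp_add]; ring_nf
    have h2 : Complex.exp ((n - l) * s) = Complex.exp (-(l * s)) * Complex.exp (n * s) := by
      rw [← Complex.exp_add]; ring_nf
    simp only [extendedOrbit, not_lt.2 (mem_Iic.1 hs), if_false, h1, h2, mul_smul, ← smul_sub]
    rw [smul_comm]
  have hμl : 0 < (μ - l).re := by simpa using hμ
  have hnl : 0 < (n - l).re := by simpa using hμ.trans hn
  have iμ : IntegrableOn (fun s : ℝ => Complex.exp ((μ - l) * s) • R μ x) (Iic 0) :=
    (integrableOn_exp_mul_complex_Iic hμl 0).smul_const _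
  have iN : IntegrableOn (fun s : ℝ => Complex.exp ((n - l) * s) • R n x) (Iic 0) :=
    (integrableOn_exp_mul_complex_Iic hnl 0).smul_const _
  have i1 := (integrableOn_exp_smul_orbit hTcont hTbdd hl (R μ (R n x))).congr_fun hpos.symm
    measurableSet_Ioi
  have i2 := IntegrableOn.congr_fun (Integrable.smul (n - μ)⁻¹ (iμ.sub iN)) hneg.symm
    measurableSet_Iic
  have hi : Integrable (fun s : ℝ => Complex.exp (-(l * s)) • extendedOrbit T R μ n x s) := by
    rw [← integrableOn_univ, ← Iic_union_Ioi (a := (0 : ℝ))]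
    exact i2.union i1
  refine ⟨hi, ?_⟩
  rw [← setIntegral_univ, ← Iic_union_Ioi (a := (0 : ℝ)),
    setIntegral_union (Iic_disjoint_Ioi le_rfl) measurableSet_Ioi i2 i1,
    setIntegral_congr_fun measurableSet_Iic hneg, setIntegral_congr_fun measurableSet_Ioi hpos,
    ← hlap l hl, integral_smul, integral_sub iμ iN, integral_smul_const, integral_smul_const,
    integral_exp_mul_complex_Iic hμl, integral_exp_mul_complex_Iic hnl]
  have n1 : μ - l ≠ 0 := fun h => by simp [h] at hμl
  have n2 : n - l ≠ 0 := fun h => by simp [h] at hnl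
  have n3 : n - μ ≠ 0 := fun h => by
    have := congrArg Complex.re h
    simp at this
    linarith
  have hwμ := hl.trans hμ
  have hwn := hwμ.trans hn
  rw [resolvent_apply_apply (sub_ne_zero.1 n1).symm (hres l μ hl hwμ),
    resolvent_apply_apply (sub_ne_zero.1 n2).symm (hres l n hl hwn),
    resolvent_apply_apply (sub_ne_zero.1 n3).symm (hres μ n hwμ hwn)]
  simp only [Complex.ofReal_zero, mul_zero, Complex.exp_zero]
  match_scalars <;> field_simp <;> ring

theorem extendedOrbit_continuousAt (hTcont : ∀ x : X, ContinuousOn (fun t => T t x) (Ici 0))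
    (μ n : ℂ) (x : X) {t : ℝ} (ht : 0 < t) : ContinuousAt (extendedOrbit T R μ n x) t := by
  refine ((hTcont (R μ (R n x))).continuousAt (Ici_mem_nhds ht)).congr ?_
  filter_upwards [Ioi_mem_nhds ht] with s hs
  simp [extendedOrbit, mem_Ioi.1 hs]

theorem resolvent_continuousOn {C : ℝ}
    (hres : ∀ l μ : ℂ, 0 ≤ l.re → 0 ≤ μ.re → R l - R μ = (μ - l) • ((R l).comp (R μ)))
    (hbdd : ∀ l : ℂ, 0 ≤ l.re → ‖R l‖ ≤ C) : ContinuousOn R {l | 0 ≤ l.re} := by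
  have hC : 0 ≤ C := (norm_nonneg _).trans (hbdd 0 le_rfl)
  refine LipschitzOnWith.continuousOn (K := ⟨C * C, by positivity⟩)
    (LipschitzOnWith.of_dist_le_mul fun l hl μ hμ => ?_)
  rw [dist_eq_norm, hres l μ hl hμ, norm_smul, dist_comm, dist_eq_norm, mul_comm]
  refine mul_le_mul_of_nonneg_right ?_ (norm_nonneg _)
  exact ((R l).opNorm_comp_le (R μ)).trans
    (mul_le_mul (hbdd l hl) (hbdd μ hμ) (norm_nonneg _) hC)

theorem resolvent_differentiableAt {C : ℝ}
    (hres : ∀ l μ : ℂ, 0 ≤ l.re → 0 ≤ μ.re → R l - R μ = (μ - l) • ((R l).comp (R μ)))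
    (hbdd : ∀ l : ℂ, 0 ≤ l.re → ‖R l‖ ≤ C) {l : ℂ} (hl : 0 < l.re) : DifferentiableAt ℂ R l := by
  have hnhds : {z : ℂ | 0 ≤ z.re} ∈ 𝓝 l :=
    mem_of_superset ((isOpen_lt continuous_const Complex.continuous_re).mem_nhds hl)
      fun z (hz : 0 < z.re) => hz.le
  have hcont : ContinuousAt R l := (resolvent_continuousOn hres hbdd).continuousAt hnhds
  have hlim : Tendsto (fun z => -((R z).comp (R l))) (𝓝[≠] l) (𝓝 (-((R l).comp (R l)))) :=
    (hcont.clm_comp continuousAt_const).neg.tendsto.mono_left nhdsWithin_le_nhds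
  refine (hasDerivAt_iff_tendsto_slope.2 (hlim.congr' ?_)).differentiableAt
  filter_upwards [nhdsWithin_le_nhds hnhds, self_mem_nhdsWithin] with z hz hzl
  rw [slope_def_module, hres z l hz hl.le, ← neg_sub z l, neg_smul, smul_neg, smul_smul,
    inv_mul_cancel₀ (sub_ne_zero.2 hzl), one_smul]

theorem norm_inv_sub_le {μ z : ℂ} (h : 1 ≤ μ.re - z.re) (hμ : μ.im = 0) :
    ‖(μ - z)⁻¹‖ ≤ 2 / (1 + |z.im|) := by
  have h1 := (le_abs_self _).trans (Complex.abs_re_le_norm (μ - z))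
  have h2 := Complex.abs_im_le_norm (μ - z)
  simp only [Complex.sub_re, Complex.sub_im, hμ, zero_sub, abs_neg] at h1 h2
  rw [norm_inv, inv_le_comm₀ (by linarith) (by positivity), inv_div]
  linarith

theorem mul_norm_inv_sub_le {n η : ℝ} (hn : 1 ≤ n) (hη : 0 ≤ η) (hη1 : η ≤ 1) (y : ℝ) :
    n * ‖((n : ℂ) - y * Complex.I)⁻¹‖ ≤ n ^ η * (2 / (1 + |y|)) ^ η := by
  have hb : ‖((n : ℂ) - y * Complex.I)⁻¹‖ ≤ 2 / (1 + |y|) := by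
    simpa using norm_inv_sub_le (μ := n) (z := y * Complex.I) (by simpa using hn) (by simp)
  have h1 := (le_abs_self _).trans (Complex.abs_re_le_norm ((n : ℂ) - y * Complex.I))
  simp only [Complex.sub_re, Complex.ofReal_re, Complex.re_ofReal_mul, Complex.I_re, mul_zero,
    sub_zero] at h1
  set A := ‖(n : ℂ) - y * Complex.I‖ with hA
  rw [norm_inv, ← hA] at hb ⊢
  have hA0 : 0 < A := by linarith
  have hle : n * A⁻¹ ≤ 1 := by rw [← div_eq_mul_inv]; exact (div_le_one hA0).2 h1
  have hpos : 0 < n * A⁻¹ := by positivity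
  calc n * A⁻¹ = (n * A⁻¹) ^ (1 : ℝ) := (Real.rpow_one _).symm
    _ ≤ (n * A⁻¹) ^ η := Real.rpow_le_rpow_of_exponent_ge hpos hle hη1
    _ = n ^ η * A⁻¹ ^ η := Real.mul_rpow (by positivity) (by positivity)
    _ ≤ _ := by gcongr

theorem orbit_eq_integral [CompleteSpace X] {C t : ℝ} (hw : 0 ≤ w)
    (hTcont : ∀ x : X, ContinuousOn (fun t => T t x) (Ici 0))
    (hTbdd : ∀ t : ℝ, 0 ≤ t → ‖T t‖ ≤ M * Real.exp (w * t))
    (hres : ∀ l μ : ℂ, 0 ≤ l.re → 0 ≤ μ.re → R l - R μ = (μ - l) • ((R l).comp (R μ)))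
    (hlap : ∀ l : ℂ, w < l.re → ∀ x : X,
      R l x = ∫ t in Ioi (0 : ℝ), Complex.exp (-(l * t)) • T t x)
    (hbdd : ∀ l : ℂ, 0 ≤ l.re → ‖R l‖ ≤ C) (ht : 0 < t) {μ n : ℝ} (hμ : μ = w + 2) (hn : μ < n)
    (x : X) :
    (2 * Real.pi) • T t (R μ (R n x)) = ∫ y : ℝ, Complex.exp (y * Complex.I * t) •
      ((μ - y * Complex.I) * (n - y * Complex.I) : ℂ)⁻¹ • R (y * Complex.I) x := by
  set b := w + 1 with hb
  have hb0 : 0 ≤ b := by linarith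
  have hC : 0 ≤ C := (norm_nonneg _).trans (hbdd 0 le_rfl)
  let G : ℂ → X := fun z => ((μ - z) * (n - z))⁻¹ • R z x
  have hne : ∀ a : ℝ, b < a → ∀ z ∈ Icc 0 b ×ℂ univ, (a - z : ℂ) ≠ 0 := by
    intro a ha z hz h
    have h1 := congrArg Complex.re h
    have h2 := hz.1.2
    simp only [Complex.sub_re, Complex.ofReal_re, Complex.zero_re] at h1
    linarith
  have hGnorm : ∀ z ∈ Icc 0 b ×ℂ univ, ‖G z‖ ≤ 4 * (C * ‖x‖) * (1 + |z.im|) ^ (-2 : ℝ) := by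
    intro z hz
    have hzb := hz.1.2
    have h1 := norm_inv_sub_le (μ := μ) (z := z) (by simp only [Complex.ofReal_re]; linarith)
      (by simp)
    have h2 := norm_inv_sub_le (μ := n) (z := z) (by simp only [Complex.ofReal_re]; linarith)
      (by simp)
    have h3 := (R z).le_of_opNorm_le (hbdd z hz.1.1) x
    simp only [G, mul_inv, norm_smul, norm_mul]
    calc ‖(μ - z : ℂ)⁻¹‖ * ‖(n - z : ℂ)⁻¹‖ * ‖R z x‖
        ≤ 2 / (1 + |z.im|) * (2 / (1 + |z.im|)) * (C * ‖x‖) := by gcongr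
      _ = _ := by
        rw [Real.rpow_neg (by positivity), Real.rpow_two]
        field_simp
        ring
  have hRx : ContinuousOn (fun z => R z x) (Icc 0 b ×ℂ univ) :=
    ((resolvent_continuousOn hres hbdd).mono fun z hz => hz.1.1).clm_apply continuousOn_const
  have hGc : ContinuousOn G (Icc 0 b ×ℂ univ) := by
    refine ContinuousOn.smul (ContinuousOn.inv₀ (by fun_prop) fun z hz => ?_) hRx
    exact mul_ne_zero (hne μ (by linarith) z hz) (hne n (by linarith) z hz)
  have hGd : DifferentiableOn ℂ G (Ioo 0 b ×ℂ univ) := by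
    intro z hz
    have hz' : z ∈ Icc 0 b ×ℂ univ := ⟨Ioo_subset_Icc_self hz.1, hz.2⟩
    refine DifferentiableAt.differentiableWithinAt (DifferentiableAt.smul
      (DifferentiableAt.inv (by fun_prop) ?_) ?_)
    · exact mul_ne_zero (hne μ (by linarith) z hz') (hne n (by linarith) z hz')
    · exact (resolvent_differentiableAt hres hbdd hz.1.1).clm_apply
        (differentiableAt_const x)
  have hlapG : ∀ y : ℝ, Integrable (fun s : ℝ => Complex.exp (-((b + y * Complex.I) * s)) •
      extendedOrbit T R μ n x s) ∧ ∫ s : ℝ, Complex.exp (-((b + y * Complex.I) * s)) •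
      extendedOrbit T R μ n x s = G (b + y * Complex.I) := fun y =>
    laplace_extendedOrbit hTcont hTbdd
      (fun l μ hl hμ => hres l μ (hw.trans hl.le) (hw.trans hμ.le)) hlap
      (by simp [hb]) (by simp [hb, hμ]) (by simpa using hn) x
  have hinv := integral_exp_smul_laplace_eq (G := G) (t := t) (by simpa using (hlapG 0).1)
    (fun y => (hlapG y).2) (integrable_vertical_of_norm_le ⟨hb0, le_rfl⟩ hGc hGnorm)
    (extendedOrbit_continuousAt hTcont μ n x ht)
  have hval : extendedOrbit T R μ n x t = T t (R μ (R n x)) := by simp [extendedOrbit, ht]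
  have hexp : Differentiable ℂ fun z : ℂ => Complex.exp (z * t) := by fun_prop
  have hshift := integral_vertical_eq_of_norm_le (F := fun z => Complex.exp (z * t) • G z)
    (K := Real.exp (b * t) * (4 * (C * ‖x‖))) hb0 (hexp.continuous.continuousOn.smul hGc)
    (hexp.differentiableOn.smul hGd) fun z hz => by
      have hzb := hz.1.2
      have := hGnorm z hz
      rw [norm_smul, Complex.norm_exp, mul_assoc]
      have hre : (z * t).re = z.re * t := by simp
      rw [hre]
      gcongr
  rw [← hval, ← hinv, hshift]

theorem norm_orbit_le [CompleteSpace X] {C η t : ℝ} (hw : 0 ≤ w)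
    (hTcont : ∀ x : X, ContinuousOn (fun t => T t x) (Ici 0))
    (hTbdd : ∀ t : ℝ, 0 ≤ t → ‖T t‖ ≤ M * Real.exp (w * t))
    (hres : ∀ l μ : ℂ, 0 ≤ l.re → 0 ≤ μ.re → R l - R μ = (μ - l) • ((R l).comp (R μ)))
    (hlap : ∀ l : ℂ, w < l.re → ∀ x : X,
      R l x = ∫ t in Ioi (0 : ℝ), Complex.exp (-(l * t)) • T t x)
    (hbdd : ∀ l : ℂ, 0 ≤ l.re → ‖R l‖ ≤ C) (hη : 0 < η) (hη1 : η ≤ 1) (ht : 0 < t) {μ n : ℝ}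
    (hμ : μ = w + 2) (hn : μ < n) (x : X) :
    n * ‖T t (R μ (R n x))‖
      ≤ (∫ y : ℝ, (1 + ‖y‖) ^ (-(1 + η))) * 2 ^ (1 + η) * C * n ^ η * ‖x‖ := by
  have hn0 : 1 ≤ n := by linarith
  have hC : 0 ≤ C := (norm_nonneg _).trans (hbdd 0 le_rfl)
  have hi : Integrable fun y : ℝ => (1 + ‖y‖) ^ (-(1 + η)) :=
    integrable_one_add_norm (by simpa using hη)
  have hpt : ∀ y : ℝ, ‖(n : ℂ) • Complex.exp (y * Complex.I * t) •
      ((μ - y * Complex.I) * (n - y * Complex.I) : ℂ)⁻¹ • R (y * Complex.I) x‖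
      ≤ (1 + ‖y‖) ^ (-(1 + η)) * (2 ^ (1 + η) * C * n ^ η * ‖x‖) := by
    intro y
    have he : ‖Complex.exp (y * Complex.I * t)‖ = 1 := by simp [Complex.norm_exp]
    have h1 : ‖((μ : ℂ) - y * Complex.I)⁻¹‖ ≤ 2 / (1 + |y|) := by
      simpa using norm_inv_sub_le (μ := μ) (z := y * Complex.I)
        (by simp; linarith) (by simp)
    have h2 := mul_norm_inv_sub_le hn0 hη.le hη1 y
    have h3 := (R (y * Complex.I)).le_of_opNorm_le (hbdd _ (by simp)) x
    have hp : (0 : ℝ) < 1 + |y| := by positivity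
    rw [norm_smul, norm_smul, norm_smul, he, mul_inv, norm_mul, Complex.norm_real,
      Real.norm_of_nonneg (by linarith), Real.norm_eq_abs]
    calc n * (1 * (‖((μ : ℂ) - y * Complex.I)⁻¹‖ * ‖((n : ℂ) - y * Complex.I)⁻¹‖ *
          ‖R (y * Complex.I) x‖))
        = ‖((μ : ℂ) - y * Complex.I)⁻¹‖ * (n * ‖((n : ℂ) - y * Complex.I)⁻¹‖) *
          ‖R (y * Complex.I) x‖ := by ring
      _ ≤ 2 / (1 + |y|) * (n ^ η * (2 / (1 + |y|)) ^ η) * (C * ‖x‖) := by gcongr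
      _ = (2 / (1 + |y|)) ^ (1 + η) * (C * n ^ η * ‖x‖) := by
        rw [Real.rpow_add (by positivity), Real.rpow_one]
        ring
      _ = _ := by
        rw [Real.div_rpow (by norm_num) hp.le, Real.rpow_neg hp.le]
        ring
  have heq := orbit_eq_integral hw hTcont hTbdd hres hlap hbdd ht hμ hn x
  have hint := norm_integral_le_of_norm_le (hi.mul_const _) (ae_of_all _ hpt)
  rw [integral_smul, ← heq, integral_mul_const, norm_smul, norm_smul, Complex.norm_real,
    Real.norm_of_nonneg (by linarith), Real.norm_of_nonneg (by positivity)] at hint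
  have hpi : 1 ≤ 2 * Real.pi := by linarith [Real.pi_gt_three]
  have hnn : 0 ≤ n * ‖T t (R μ (R n x))‖ := by positivity
  nlinarith [mul_le_mul_of_nonneg_right hpi hnn]

/-- If the resolvent is bounded on the closed right half-plane, the classical solutions grow at an
arbitrarily small exponential rate. -/
theorem exists_norm_comp_resolvent_le [CompleteSpace X] {C η : ℝ} (hw : 0 ≤ w) (hM : 0 ≤ M)
    (hTcont : ∀ x : X, ContinuousOn (fun t => T t x) (Ici 0))
    (hTbdd : ∀ t : ℝ, 0 ≤ t → ‖T t‖ ≤ M * Real.exp (w * t))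
    (hres : ∀ l μ : ℂ, 0 ≤ l.re → 0 ≤ μ.re → R l - R μ = (μ - l) • ((R l).comp (R μ)))
    (hlap : ∀ l : ℂ, w < l.re → ∀ x : X,
      R l x = ∫ t in Ioi (0 : ℝ), Complex.exp (-(l * t)) • T t x)
    (hbdd : ∀ l : ℂ, 0 ≤ l.re → ‖R l‖ ≤ C) (hη : 0 < η) (hη1 : η ≤ 1) :
    ∃ K : ℝ, 0 ≤ K ∧ ∀ t : ℝ, 0 < t →
      ‖(T t).comp (R (w + 2 : ℝ))‖ ≤ K * Real.exp (η * w * t) := by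
  have hC : 0 ≤ C := (norm_nonneg _).trans (hbdd 0 le_rfl)
  set μ := w + 2 with hμ
  set J := ∫ y : ℝ, (1 + ‖y‖) ^ (-(1 + η)) with hJ
  have hJ0 : 0 ≤ J := integral_nonneg fun y => by positivity
  have hμ0 : 0 ≤ μ := by linarith
  refine ⟨J * 2 ^ (1 + η) * C * (w + 3) ^ η + M * (M * (1 + μ * C)), by positivity,
    fun t ht => ContinuousLinearMap.opNorm_le_bound _ (by positivity) fun x => ?_⟩
  have hE1 : 1 ≤ Real.exp (w * t) := Real.one_le_exp (by positivity)
  set n := (w + 3) * Real.exp (w * t) with hn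
  have hnw : Real.exp (w * t) ≤ n - w := by nlinarith
  have hμn : μ < n := by nlinarith
  have hwn : w < n := by linarith
  have hn0 : 0 < n := by linarith
  have hRn : ‖R n‖ ≤ M / Real.exp (w * t) :=
    (norm_laplace_le hM hTbdd hlap (l := n) (by simpa using hwn)).trans
      (by rw [Complex.ofReal_re]; gcongr)
  have hsplit : R μ x = (n : ℂ) • R μ (R n x) + (R n x - (μ : ℂ) • R μ (R n x)) := by
    have h := congrArg (fun S : X →L[ℂ] X => S x) (hres μ n (by simpa using hμ0)
      (by simpa using hn0.le))
    simp only [sub_apply, smul_apply,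
      ContinuousLinearMap.comp_apply, sub_smul] at h
    rw [sub_eq_iff_eq_add] at h
    rw [h]
    abel
  have hmain : ‖T t ((n : ℂ) • R μ (R n x))‖
      ≤ J * 2 ^ (1 + η) * C * (w + 3) ^ η * Real.exp (η * w * t) * ‖x‖ := by
    have h := norm_orbit_le hw hTcont hTbdd hres hlap hbdd hη hη1 ht hμ hμn x
    rw [map_smul, norm_smul, Complex.norm_real, Real.norm_of_nonneg hn0.le]
    refine h.trans_eq ?_
    rw [hn, Real.mul_rpow (by positivity) (by positivity), ← Real.exp_mul, hJ]
    ring_nf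
  have hrest : ‖T t (R n x - (μ : ℂ) • R μ (R n x))‖ ≤ M * (M * (1 + μ * C)) * ‖x‖ := by
    have h1 : ‖R n x‖ ≤ M / Real.exp (w * t) * ‖x‖ := (R n).le_of_opNorm_le hRn x
    have h2 : ‖R μ (R n x)‖ ≤ C * ‖R n x‖ :=
      (R μ).le_of_opNorm_le (hbdd _ (by simpa using hμ0)) _
    have h3 : ‖R n x - (μ : ℂ) • R μ (R n x)‖ ≤ (1 + μ * C) * ‖R n x‖ := by
      refine (norm_sub_le _ _).trans ?_
      rw [norm_smul, Complex.norm_real, Real.norm_of_nonneg hμ0]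
      nlinarith
    calc _ ≤ M * Real.exp (w * t) * ‖R n x - (μ : ℂ) • R μ (R n x)‖ :=
          (T t).le_of_opNorm_le (hTbdd t ht.le) _
      _ ≤ M * Real.exp (w * t) * ((1 + μ * C) * (M / Real.exp (w * t) * ‖x‖)) := by
          gcongr
          exact h3.trans (by gcongr)
      _ = _ := by field_simp
  have hE2 : 1 ≤ Real.exp (η * w * t) := Real.one_le_exp (by positivity)
  rw [ContinuousLinearMap.comp_apply, hsplit, map_add]
  calc _ ≤ _ := norm_add_le _ _
    _ ≤ J * 2 ^ (1 + η) * C * (w + 3) ^ η * Real.exp (η * w * t) * ‖x‖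
        + M * (M * (1 + μ * C)) * Real.exp (η * w * t) * ‖x‖ := by
      refine add_le_add hmain (hrest.trans (mul_le_mul_of_nonneg_right ?_ (norm_nonneg x)))
      exact le_mul_of_one_le_right (by positivity) hE2
    _ = _ := by ring

end

/-- The resolvent at `l - δ` expressed by the resolvent `P` at `l`. -/
noncomputable def shiftedResolvent {A : Type*} [Ring A] [Algebra ℂ A] (δ : ℂ) (P : A) : A :=
  Ring.inverse (1 - δ • P) * P

section ShiftedResolvent

variable {A : Type*} [Ring A] [Algebra ℂ A] {δ : ℂ} {P Q : A}

theorem one_sub_mul_shiftedResolvent (hP : IsUnit (1 - δ • P)) :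
    (1 - δ • P) * shiftedResolvent δ P = P := by
  rw [shiftedResolvent, ← mul_assoc, Ring.mul_inverse_cancel _ hP, one_mul]

theorem shiftedResolvent_mul_one_sub (hP : IsUnit (1 - δ • P)) :
    shiftedResolvent δ P * (1 - δ • P) = P := by
  have hcomm : P * (1 - δ • P) = (1 - δ • P) * P := by simp [mul_sub, sub_mul]
  rw [shiftedResolvent, mul_assoc, hcomm, ← mul_assoc, Ring.inverse_mul_cancel _ hP, one_mul]

theorem shiftedResolvent_eq (hP : IsUnit (1 - δ • P)) (h : Q - P = δ • (Q * P)) :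
    shiftedResolvent δ P = Q := by
  refine hP.mul_left_injective ?_
  have h1 : Q * (1 - δ • P) = P := by
    rw [mul_sub, mul_one, mul_smul_comm, ← h, sub_sub_cancel]
  simp only [h1, shiftedResolvent_mul_one_sub hP]

theorem shiftedResolvent_sub (hP : IsUnit (1 - δ • P)) (hQ : IsUnit (1 - δ • Q)) {c : ℂ}
    (h : P - Q = c • (P * Q)) :
    shiftedResolvent δ P - shiftedResolvent δ Q
      = c • (shiftedResolvent δ P * shiftedResolvent δ Q) := by
  have hP' := one_sub_mul_shiftedResolvent hP
  have hQ' := shiftedResolvent_mul_one_sub hQ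
  refine hP.mul_right_injective (hQ.mul_left_injective ?_)
  calc (1 - δ • P) * (shiftedResolvent δ P - shiftedResolvent δ Q) * (1 - δ • Q)
      = ((1 - δ • P) * shiftedResolvent δ P) * (1 - δ • Q)
        - (1 - δ • P) * (shiftedResolvent δ Q * (1 - δ • Q)) := by
          rw [mul_sub _ (shiftedResolvent δ P), sub_mul, mul_assoc _ (shiftedResolvent δ Q)]
    _ = c • (P * Q) := by
      rw [hP', hQ', ← h, mul_sub, sub_mul, mul_smul_comm, smul_mul_assoc, mul_one, one_mul]
      abel
    _ = c • (((1 - δ • P) * shiftedResolvent δ P) * (shiftedResolvent δ Q * (1 - δ • Q))) := by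
      rw [hP', hQ']
    _ = _ := by simp only [mul_smul_comm, smul_mul_assoc, mul_assoc]

end ShiftedResolvent

theorem norm_shiftedResolvent_le {A : Type*} [NormedRing A] [NormedAlgebra ℂ A] {δ : ℂ} {P : A}
    {C : ℝ} (hP : IsUnit (1 - δ • P)) (hC : ‖P‖ ≤ C) (hδ : ‖δ‖ * C ≤ 1 / 2) :
    ‖shiftedResolvent δ P‖ ≤ 2 * C := by
  have h : shiftedResolvent δ P = P + δ • (P * shiftedResolvent δ P) := by
    have := one_sub_mul_shiftedResolvent hP
    rw [sub_mul, one_mul, smul_mul_assoc, sub_eq_iff_eq_add] at this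
    exact this
  have h1 : ‖shiftedResolvent δ P‖ ≤ C + ‖δ‖ * (C * ‖shiftedResolvent δ P‖) := by
    conv_lhs => rw [h]
    refine (norm_add_le _ _).trans (add_le_add hC ?_)
    rw [norm_smul]
    gcongr
    exact (norm_mul_le _ _).trans (by gcongr)
  nlinarith [mul_le_mul_of_nonneg_right hδ (norm_nonneg (shiftedResolvent δ P))]

/-- On an arbitrary Banach space, uniform boundedness of the resolvent on the
closed right half-plane implies exponential decay of classical solutions: for every `μ` with
`Re μ > max(ω₀,0)` there are `C ≥ 0` and `ω < 0` with `‖T(t) R(μ)‖ ≤ C e^{ωt}` for `t ≥ 0`. -/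
theorem exp_decay_classical_solutions
    {X : Type*} [NormedAddCommGroup X] [NormedSpace ℂ X] [CompleteSpace X]
    (T : ℝ → (X →L[ℂ] X)) (M₀ ω₀ : ℝ) (hM₀ : 1 ≤ M₀)
    (hT0 : T 0 = 1)
    (hTsemi : ∀ s t : ℝ, 0 ≤ s → 0 ≤ t → T (s + t) = (T s).comp (T t))
    (hTcont : ∀ x : X, ContinuousOn (fun t => T t x) (Set.Ici 0))
    (hTbdd : ∀ t : ℝ, 0 ≤ t → ‖T t‖ ≤ M₀ * Real.exp (ω₀ * t))
    (R : ℂ → (X →L[ℂ] X))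
    (hres : ∀ l μ : ℂ, (0 ≤ l.re ∨ ω₀ < l.re) → (0 ≤ μ.re ∨ ω₀ < μ.re) →
      R l - R μ = (μ - l) • ((R l).comp (R μ)))
    (hlap : ∀ l : ℂ, max ω₀ 0 < l.re → ∀ x : X,
      R l x = ∫ t in Set.Ioi (0:ℝ), Complex.exp (-(l * t)) • T t x)
    (C₀ : ℝ) (hbdd : ∀ l : ℂ, 0 ≤ l.re → ‖R l‖ ≤ C₀) :
    ∀ μ : ℂ, max ω₀ 0 < μ.re → ∃ C : ℝ, 0 ≤ C ∧ ∃ ω : ℝ, ω < 0 ∧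
      ∀ t : ℝ, 0 ≤ t → ‖(T t).comp (R μ)‖ ≤ C * Real.exp (ω * t) := by
  intro μ hμ
  have hC₀ : 0 ≤ C₀ := (norm_nonneg _).trans (hbdd 0 le_rfl)
  have hmax : 0 ≤ max ω₀ 0 := le_max_right _ _
  obtain ⟨δ, hδ, hδC⟩ : ∃ δ : ℝ, 0 < δ ∧ δ * C₀ ≤ 1 / 2 := by
    refine ⟨1 / (2 * (C₀ + 1)), by positivity, ?_⟩
    rw [div_mul_eq_mul_div, div_le_div_iff₀ (by positivity) (by positivity)]
    linarith
  have hδC' : ‖(δ : ℂ)‖ * C₀ ≤ 1 / 2 := by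
    rwa [Complex.norm_real, Real.norm_of_nonneg hδ.le]
  set w := max ω₀ 0 + δ with hw
  have hw0 : 0 < w := by linarith
  have hunit : ∀ l : ℂ, 0 ≤ l.re → IsUnit (1 - (δ : ℂ) • R l) := fun l hl => by
    refine isUnit_one_sub_of_norm_lt_one ?_
    rw [norm_smul]
    have := mul_le_mul_of_nonneg_left (hbdd l hl) (norm_nonneg (δ : ℂ))
    linarith
  have hshift : ∀ l : ℂ, w < l.re → shiftedResolvent (δ : ℂ) (R l) = R (l - δ) := fun l hl => by
    have hl0 : 0 ≤ l.re := by linarith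
    refine shiftedResolvent_eq (hunit l hl0) ?_
    have h := hres (l - δ) l
      (Or.inl (by simp only [Complex.sub_re, Complex.ofReal_re]; linarith)) (Or.inl hl0)
    rwa [sub_sub_cancel] at h
  obtain ⟨K, hK, hKt⟩ := exists_norm_comp_resolvent_le
    (T := fun t => Complex.exp (δ * t) • T t) (R := fun l => shiftedResolvent (δ : ℂ) (R l))
    (M := M₀) (w := w) (C := 2 * C₀) (η := δ / (2 * w)) hw0.le (by linarith)
    (fun x => by
      have h : Continuous fun t : ℝ => Complex.exp (δ * t) := by fun_prop
      exact h.continuousOn.smul (hTcont x))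
    (fun t ht => by
      have hre : ((δ : ℂ) * t).re = δ * t := by simp
      rw [norm_smul, Complex.norm_exp, hre]
      calc Real.exp (δ * t) * ‖T t‖ ≤ Real.exp (δ * t) * (M₀ * Real.exp (max ω₀ 0 * t)) := by
            gcongr
            refine (hTbdd t ht).trans ?_
            gcongr
            exact le_max_left _ _
        _ = M₀ * Real.exp (w * t) := by
            rw [hw, add_mul, Real.exp_add]
            ring)
    (fun l ν hl hν => shiftedResolvent_sub (hunit l hl) (hunit ν hν)
      (hres l ν (Or.inl hl) (Or.inl hν)))
    (fun l hl x => by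
      rw [hshift l hl, hlap _ (by simp only [Complex.sub_re, Complex.ofReal_re]; linarith)]
      refine integral_congr_ae (ae_of_all _ fun t => ?_)
      simp only [smul_apply, smul_smul, ← Complex.exp_add]
      congr 2
      ring)
    (fun l hl => norm_shiftedResolvent_le (hunit l hl) (hbdd l hl) hδC')
    (by positivity) ((div_le_one (by positivity)).2 (by linarith))
  set m : ℂ := ((w + 2 : ℝ) : ℂ) - δ with hm
  have hrate : δ / (2 * w) * w = δ / 2 := by field_simp
  have hdecay : ∀ t : ℝ, 0 < t → ‖(T t).comp (R m)‖ ≤ K * Real.exp (-(δ / 2) * t) := by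
    intro t ht
    have h := hKt t ht
    have hre : ((δ : ℂ) * t).re = δ * t := by simp
    rw [hshift _ (by simp), ContinuousLinearMap.smul_comp, norm_smul, Complex.norm_exp, hre,
      hrate] at h
    have hE : Real.exp (-(δ / 2) * t) = Real.exp (δ / 2 * t) / Real.exp (δ * t) := by
      rw [← Real.exp_sub]
      ring_nf
    rw [hE, ← mul_div_assoc, le_div_iff₀ (Real.exp_pos _)]
    linarith
  have hfac : R μ = (R m).comp (1 + (m - μ) • R μ) := by
    have h := hres m μ (Or.inl (by simp [hm]; linarith)) (Or.inl (by linarith))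
    rw [ContinuousLinearMap.comp_add, ContinuousLinearMap.comp_smul, ← neg_sub μ m, neg_smul, ← h]
    ext x
    simp
  refine ⟨K * ‖1 + (m - μ) • R μ‖ + ‖(T 0).comp (R μ)‖, by positivity, -(δ / 2), by linarith,
    fun t ht => ?_⟩
  rcases ht.eq_or_lt with rfl | ht
  · rw [mul_zero, Real.exp_zero, mul_one]
    exact le_add_of_nonneg_left (by positivity)
  · calc ‖(T t).comp (R μ)‖ = ‖((T t).comp (R m)).comp (1 + (m - μ) • R μ)‖ := by
          rw [ContinuousLinearMap.comp_assoc, ← hfac]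
      _ ≤ K * Real.exp (-(δ / 2) * t) * ‖1 + (m - μ) • R μ‖ :=
          (ContinuousLinearMap.opNorm_comp_le _ _).trans
            (mul_le_mul_of_nonneg_right (hdecay t ht) (norm_nonneg _))
      _ ≤ _ := by
          rw [add_mul]
          have : 0 ≤ ‖(T 0).comp (R μ)‖ * Real.exp (-(δ / 2) * t) := by positivity
          linarith
end

section
/- Let X be a complex Hilbert space and T a C₀-semigroup on X with ‖T(t)‖ ≤ M₀ e^{ω₀ t}. Let R : D → L(X), where D := {Re λ ≥ 0} ∪ {Re λ > ω₀}, satisfy the resolvent identity on D and the Laplace-transform identity R(λ)x = ∫₀^∞ e^{−λt} T(t)x dt for Re λ > max(ω₀, 0), and assume sup_{Re λ ≥ 0} ‖R(λ)‖ < ∞. Then there exist C ≥ 0 and ω < 0 such that ‖T(t)‖ ≤ C e^{ω t} for all t ≥ 0. (The Gearhart–Prüss theorem: on Hilbert spaces, uniform boundedness of the resolvent on the closed right half-plane implies exponential stability; the case p = 2 of the paper's Fourier-type decay theorem.) -/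
open MeasureTheory FourierTransform

theorem eLpNorm_fourier_eq {X : Type*} [NormedAddCommGroup X] [InnerProductSpace ℂ X]
    [CompleteSpace X] {f : ℝ → X} (h1 : Integrable f) (h2 : MemLp f 2) :
    eLpNorm (𝓕 f) 2 volume = eLpNorm f 2 volume := by
  set u : Lp X 2 (volume : Measure ℝ) := h2.toLp f with hu
  have key : (𝓕 u : Lp X 2 (volume : Measure ℝ)) =ᵐ[volume] 𝓕 f := by
    apply ae_eq_of_integral_contDiff_smul_eq
    · exact (Lp.memLp _).locallyIntegrable (by norm_num)
    · refine Continuous.locallyIntegrable ?_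
      exact VectorFourier.fourierIntegral_continuous Real.continuous_fourierChar
        continuous_inner h1
    · intro g hg hc
      have hc' : HasCompactSupport (fun x => (g x : ℂ)) := hc.comp_left Complex.ofReal_zero
      let G : SchwartzMap ℝ ℂ := hc'.toSchwartzMap (Complex.ofRealCLM.contDiff.comp hg)
      have hG : ∀ x, G x = (g x : ℂ) := fun x => rfl
      have e := congrArg (fun D => D G) (Lp.fourier_toTemperedDistribution_eq u)
      simp only [TemperedDistribution.fourier_apply, Lp.toTemperedDistribution_apply, hG,
        Complex.coe_smul] at e
      rw [← e]
      have e2 : ∫ ξ, (𝓕 (G : ℝ → ℂ)) ξ • f ξ = ∫ x, G x • 𝓕 f x := by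
        simpa using! VectorFourier.integral_fourierIntegral_smul_eq_flip
          (L := innerₗ ℝ) Real.continuous_fourierChar continuous_inner G.integrable h1
      simp only [hG, Complex.coe_smul] at e2
      rw [← e2]
      refine integral_congr_ae ?_
      filter_upwards [h2.coeFn_toLp] with x hx
      rw [hu, hx, SchwartzMap.fourier_coe]
  rw [← eLpNorm_congr_ae key, ← eLpNorm_congr_ae h2.coeFn_toLp]
  have := congrArg ENNReal.ofReal (Lp.norm_fourier_eq u)
  simpa [Lp.norm_def, ENNReal.ofReal_toReal, Lp.eLpNorm_ne_top] using this

theorem integral_sq_norm_le_of_norm_fourier_le {X : Type*} [NormedAddCommGroup X]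
    [InnerProductSpace ℂ X] [CompleteSpace X] {f g : ℝ → X} (hf1 : Integrable f)
    (hf2 : MemLp f 2) (hg1 : Integrable g) (hg2 : MemLp g 2) {c : ℝ} (hc : 0 ≤ c)
    (h : ∀ ξ, ‖𝓕 f ξ‖ ≤ c * ‖𝓕 g ξ‖) :
    ∫ t, ‖f t‖ ^ 2 ≤ c ^ 2 * ∫ t, ‖g t‖ ^ 2 := by
  have hsq : ∀ {u : ℝ → X}, MemLp u 2 → ∫ t, ‖u t‖ ^ 2 = (eLpNorm u 2 volume).toReal ^ 2 := by
    intro u hu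
    have h0 : 0 ≤ ∫ t, ‖u t‖ ^ 2 := integral_nonneg fun t => sq_nonneg _
    rw [hu.eLpNorm_eq_integral_rpow_norm (by norm_num) (by norm_num)]
    simp only [ENNReal.toReal_ofNat, Real.rpow_ofNat]
    rw [ENNReal.toReal_ofReal (by positivity), ← Real.rpow_natCast, ← Real.rpow_mul h0]
    norm_num
  have hle : eLpNorm f 2 volume ≤ ENNReal.ofReal c * eLpNorm g 2 volume := by
    rw [← eLpNorm_fourier_eq hf1 hf2, ← eLpNorm_fourier_eq hg1 hg2]
    exact eLpNorm_le_mul_eLpNorm_of_ae_le_mul (Filter.Eventually.of_forall h) 2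
  rw [hsq hf2, hsq hg2, ← mul_pow]
  refine pow_le_pow_left₀ ENNReal.toReal_nonneg ?_ 2
  have := ENNReal.toReal_mono (ENNReal.mul_ne_top ENNReal.ofReal_ne_top hg2.eLpNorm_ne_top) hle
  rwa [ENNReal.toReal_mul, ENNReal.toReal_ofReal hc] at this

section Semigroup

variable {X : Type*} [NormedAddCommGroup X] [NormedSpace ℂ X] {T : ℝ → (X →L[ℂ] X)}

theorem norm_weighted_orbit_le {M ω : ℝ} (hT : ∀ t, 0 ≤ t → ‖T t‖ ≤ M * Real.exp (ω * t))
    (l : ℂ) (x : X) {t : ℝ} (ht : 0 ≤ t) :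
    ‖Complex.exp (-(l * t)) • T t x‖ ≤ M * ‖x‖ * Real.exp (-(l.re - ω) * t) := by
  have h : Real.exp (-(l.re - ω) * t) = Real.exp (-(l.re * t)) * Real.exp (ω * t) := by
    rw [← Real.exp_add]; ring_nf
  rw [norm_smul, Complex.norm_exp, h]
  have : (-(l * t)).re = -(l.re * t) := by simp
  rw [this]
  calc _ ≤ Real.exp (-(l.re * t)) * (M * Real.exp (ω * t) * ‖x‖) := by
        gcongr; exact (T t).le_of_opNorm_le (hT t ht) x
    _ = _ := by ring

theorem continuousOn_weighted_orbit {x : X} (hc : ContinuousOn (fun t => T t x) (Set.Ici 0))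
    (l : ℂ) : ContinuousOn (fun t : ℝ => Complex.exp (-(l * t)) • T t x) (Set.Ici 0) :=
  ContinuousOn.smul (by fun_prop) hc

theorem integrableOn_weighted_orbit {x : X} {M ω : ℝ}
    (hc : ContinuousOn (fun t => T t x) (Set.Ici 0))
    (hT : ∀ t, 0 ≤ t → ‖T t‖ ≤ M * Real.exp (ω * t)) {l : ℂ} (hl : ω < l.re) :
    IntegrableOn (fun t : ℝ => Complex.exp (-(l * t)) • T t x) (Set.Ioi 0) := by
  refine Integrable.mono' ((exp_neg_integrableOn_Ioi 0 (sub_pos.2 hl)).const_mul (M * ‖x‖))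
    (((continuousOn_weighted_orbit hc l).mono Set.Ioi_subset_Ici_self).aestronglyMeasurable
      measurableSet_Ioi) ?_
  filter_upwards [ae_restrict_mem measurableSet_Ioi] with t ht
  exact norm_weighted_orbit_le hT l x (le_of_lt ht)

theorem integrableOn_sq_weighted_orbit {x : X} {M ω : ℝ}
    (hc : ContinuousOn (fun t => T t x) (Set.Ici 0))
    (hT : ∀ t, 0 ≤ t → ‖T t‖ ≤ M * Real.exp (ω * t)) {l : ℂ} (hl : ω < l.re) :
    IntegrableOn (fun t : ℝ => ‖Complex.exp (-(l * t)) • T t x‖ ^ 2) (Set.Ioi 0) := by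
  have h2 : 0 < 2 * (l.re - ω) := by linarith
  refine Integrable.mono' ((exp_neg_integrableOn_Ioi 0 h2).const_mul ((M * ‖x‖) ^ 2))
    ((((continuousOn_weighted_orbit hc l).mono Set.Ioi_subset_Ici_self).norm.pow
      2).aestronglyMeasurable measurableSet_Ioi) ?_
  filter_upwards [ae_restrict_mem measurableSet_Ioi] with t ht
  rw [norm_pow, norm_norm]
  calc _ ≤ (M * ‖x‖ * Real.exp (-(l.re - ω) * t)) ^ 2 := by
        gcongr; exact norm_weighted_orbit_le hT l x (le_of_lt ht)
    _ = _ := by rw [mul_pow, ← Real.exp_nat_mul]; push_cast; ring_nf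

theorem integral_sq_weighted_orbit_le {x : X} {M ω : ℝ}
    (hc : ContinuousOn (fun t => T t x) (Set.Ici 0))
    (hT : ∀ t, 0 ≤ t → ‖T t‖ ≤ M * Real.exp (ω * t)) {l : ℂ} (hl : ω < l.re) :
    ∫ t in Set.Ioi (0 : ℝ), ‖Complex.exp (-(l * t)) • T t x‖ ^ 2
      ≤ M ^ 2 / (2 * (l.re - ω)) * ‖x‖ ^ 2 := by
  have h2 : 0 < 2 * (l.re - ω) := by linarith
  calc _ ≤ ∫ t in Set.Ioi (0 : ℝ), (M * ‖x‖) ^ 2 * Real.exp (-(2 * (l.re - ω)) * t) := by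
        refine setIntegral_mono_on (integrableOn_sq_weighted_orbit hc hT hl)
          ((exp_neg_integrableOn_Ioi 0 h2).const_mul _) measurableSet_Ioi fun t ht => ?_
        calc _ ≤ (M * ‖x‖ * Real.exp (-(l.re - ω) * t)) ^ 2 := by
              gcongr; exact norm_weighted_orbit_le hT l x (le_of_lt ht)
          _ = _ := by rw [mul_pow, ← Real.exp_nat_mul]; push_cast; ring_nf
    _ = _ := by
        rw [integral_const_mul, integral_exp_mul_Ioi (by linarith)]
        simp only [mul_zero, Real.exp_zero]
        field_simp

variable [CompleteSpace X]

/-- If `Rx` is the Laplace transform of an orbit at `m`, then the orbit of `Rx` is explicit. -/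
theorem weighted_orbit_laplace_eq
    (hTsemi : ∀ s t : ℝ, 0 ≤ s → 0 ≤ t → T (s + t) = (T s).comp (T t)) {x : X} {m : ℂ}
    (hi : IntegrableOn (fun t : ℝ => Complex.exp (-(m * t)) • T t x) (Set.Ioi 0))
    {t : ℝ} (ht : 0 ≤ t) :
    Complex.exp (-(m * t)) • T t (∫ s in Set.Ioi (0 : ℝ), Complex.exp (-(m * s)) • T s x) =
      (∫ s in Set.Ioi (0 : ℝ), Complex.exp (-(m * s)) • T s x) -
        ∫ s in (0 : ℝ)..t, Complex.exp (-(m * s)) • T s x := by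
  rw [← ContinuousLinearMap.integral_comp_comm _ hi, ← integral_smul]
  have h1 : ∫ s in Set.Ioi (0 : ℝ), Complex.exp (-(m * t)) •
      T t (Complex.exp (-(m * s)) • T s x) =
      ∫ s in Set.Ioi t, Complex.exp (-(m * s)) • T s x := by
    rw [← (measurePreserving_add_right volume t).setIntegral_preimage_emb
      (measurableEmbedding_addRight t) _ (Set.Ioi t), Set.preimage_add_const_Ioi, sub_self]
    refine setIntegral_congr_fun measurableSet_Ioi fun s hs => ?_
    rw [add_comm s t, hTsemi t s ht (le_of_lt hs), map_smul, smul_smul, ← Complex.exp_add]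
    simp only [ContinuousLinearMap.comp_apply]
    congr 2
    push_cast
    ring
  rw [h1, intervalIntegral.integral_of_le ht, eq_sub_iff_add_eq, add_comm,
    ← setIntegral_union (Set.Ioc_disjoint_Ioi le_rfl) measurableSet_Ioi
      (hi.mono_set Set.Ioc_subset_Ioi_self) (hi.mono_set (Set.Ioi_subset_Ioi ht)),
    Set.Ioc_union_Ioi_eq_Ioi ht]

theorem laplace_resolvent_shift (hT0 : T 0 = 1)
    (hTsemi : ∀ s t : ℝ, 0 ≤ s → 0 ≤ t → T (s + t) = (T s).comp (T t)) {x z : X} {m l : ℂ}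
    (hc : ∀ x, ContinuousOn (fun t => T t x) (Set.Ici 0))
    {M ω : ℝ} (hT : ∀ t, 0 ≤ t → ‖T t‖ ≤ M * Real.exp (ω * t)) (hl : ω < l.re)
    (hm : ω < m.re) (hz : z = ∫ s in Set.Ioi (0 : ℝ), Complex.exp (-(m * s)) • T s x) :
    ∫ t in Set.Ioi (0 : ℝ), Complex.exp (-(l * t)) • T t (x - (m - l) • z) = z := by
  have hi := integrableOn_weighted_orbit (hc x) hT hm
  have key : ∀ t : ℝ, 0 ≤ t → Complex.exp (-(m * t)) • T t z =
      z - ∫ s in (0 : ℝ)..t, Complex.exp (-(m * s)) • T s x := fun t ht => by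
    rw [hz]; exact weighted_orbit_laplace_eq hTsemi hi ht
  have hfac : ∀ t : ℝ, Complex.exp (-(l * t)) =
      Complex.exp ((m - l) * t) * Complex.exp (-(m * t)) := fun t => by
    rw [← Complex.exp_add]; ring_nf
  have hlim : Filter.Tendsto (fun t : ℝ => Complex.exp (-(l * t)) • T t z) Filter.atTop
      (nhds 0) := by
    have h0 : Filter.Tendsto (fun t : ℝ => M * ‖z‖ * Real.exp (-(l.re - ω) * t)) Filter.atTop
        (nhds 0) := by
      rw [← mul_zero (M * ‖z‖)]
      refine (Real.tendsto_exp_atBot.comp ?_).const_mul _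
      exact Filter.tendsto_id.const_mul_atTop_of_neg (by linarith)
    refine squeeze_zero_norm' ?_ h0
    filter_upwards [Filter.eventually_ge_atTop 0] with t ht
    exact norm_weighted_orbit_le hT l z ht
  have hder : ∀ t ∈ Set.Ioi (0 : ℝ), HasDerivAt
      (fun t : ℝ => Complex.exp (-(l * t)) • T t z)
      (-(Complex.exp (-(l * t)) • T t (x - (m - l) • z))) t := by
    intro t ht
    have ht0 : (0 : ℝ) < t := ht
    have hca := continuousOn_weighted_orbit (hc x) m
    have h1 : HasDerivAt (fun t : ℝ => ∫ s in (0 : ℝ)..t, Complex.exp (-(m * s)) • T s x)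
        (Complex.exp (-(m * t)) • T t x) t := by
      refine intervalIntegral.integral_hasDerivAt_right ?_ ?_ ?_
      · refine (hca.mono ?_).intervalIntegrable
        rw [Set.uIcc_of_le ht0.le]
        exact Set.Icc_subset_Ici_self
      · exact (hca.mono Set.Ioi_subset_Ici_self).stronglyMeasurableAtFilter isOpen_Ioi t ht
      · exact hca.continuousAt (Ici_mem_nhds ht0)
    have h2 : HasDerivAt (fun t : ℝ => Complex.exp ((m - l) * t))
        ((m - l) * Complex.exp ((m - l) * t)) t := by
      have : HasDerivAt (fun w : ℂ => Complex.exp ((m - l) * w))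
          (Complex.exp ((m - l) * t) * ((m - l) * 1)) t :=
        ((hasDerivAt_id (t : ℂ)).const_mul (m - l)).cexp
      convert this.comp_ofReal using 1
      ring
    have h3 := h2.smul (h1.const_sub z)
    have h4 := h3.congr_of_eventuallyEq
      (f₁ := fun t : ℝ => Complex.exp (-(l * t)) • T t z) <| by
      filter_upwards [Ioi_mem_nhds ht0] with s hs
      simp only [Pi.smul_apply', hfac s]
      rw [mul_smul, key s (le_of_lt hs)]
    convert h4 using 1
    rw [← key t ht0.le, map_sub, map_smul, hfac t]
    module
  have := integral_Ioi_of_hasDerivAt_of_tendsto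
    ((continuousOn_weighted_orbit (hc z) l) 0 Set.self_mem_Ici) hder
    (integrableOn_weighted_orbit (hc _) hT hl).neg hlim
  simpa [integral_neg, hT0] using this

theorem laplace_eq_resolvent (hT0 : T 0 = 1)
    (hTsemi : ∀ s t : ℝ, 0 ≤ s → 0 ≤ t → T (s + t) = (T s).comp (T t)) {m l : ℂ}
    (hc : ∀ x, ContinuousOn (fun t => T t x) (Set.Ici 0))
    {M ω : ℝ} (hT : ∀ t, 0 ≤ t → ‖T t‖ ≤ M * Real.exp (ω * t)) (hl : ω < l.re)
    (hm : ω < m.re) {Rl Rm : X →L[ℂ] X}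
    (hRm : ∀ x, Rm x = ∫ s in Set.Ioi (0 : ℝ), Complex.exp (-(m * s)) • T s x)
    (h1 : Rl - Rm = (m - l) • Rl.comp Rm) (h2 : Rm - Rl = (l - m) • Rm.comp Rl) (x : X) :
    Rl x = ∫ s in Set.Ioi (0 : ℝ), Complex.exp (-(l * s)) • T s x := by
  have e1 : ∀ y, Rl y - Rm y = (m - l) • Rl (Rm y) := fun y => by
    simpa using congrArg (fun A : X →L[ℂ] X => A y) h1
  have e2 : ∀ y, Rm y - Rl y = (l - m) • Rm (Rl y) := fun y => by
    simpa using congrArg (fun A : X →L[ℂ] X => A y) h2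
  have hz : Rm (x + (m - l) • Rl x) = Rl x := by
    have := e2 x
    rw [map_add, map_smul]
    have h : (m - l) • Rm (Rl x) = -((l - m) • Rm (Rl x)) := by module
    rw [h, ← this]
    abel
  have := laplace_resolvent_shift hT0 hTsemi hc hT hl hm (hRm (x + (m - l) • Rl x))
  rw [hz] at this
  simpa using this.symm

end Semigroup

section Datko

variable {X : Type*} [NormedAddCommGroup X] [NormedSpace ℂ X] {S : ℝ → (X →L[ℂ] X)}

theorem mul_sq_norm_orbit_le
    (hS : ∀ s t : ℝ, 0 ≤ s → 0 ≤ t → S (s + t) = (S s).comp (S t)) {x : X} {K c a t : ℝ}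
    (hc : ContinuousOn (fun t => S t x) (Set.Ici 0))
    (hK : ∀ N, 0 ≤ N → ∫ t in (0 : ℝ)..N, ‖S t x‖ ^ 2 ≤ K * ‖x‖ ^ 2)
    (ha : 0 ≤ a) (hat : a ≤ t) (hb : ∀ r, 0 ≤ r → r ≤ t - a → ‖S r‖ ≤ c) :
    (t - a) * ‖S t x‖ ^ 2 ≤ c ^ 2 * K * ‖x‖ ^ 2 := by
  have hi : ∀ u v : ℝ, 0 ≤ u → u ≤ v →
      IntervalIntegrable (fun t => ‖S t x‖ ^ 2) volume u v := fun u v hu huv =>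
    ContinuousOn.intervalIntegrable <| (hc.norm.pow 2).mono <| by
      rw [Set.uIcc_of_le huv]
      exact fun y hy => hu.trans hy.1
  calc (t - a) * ‖S t x‖ ^ 2 = ∫ s in a..t, ‖S t x‖ ^ 2 := by simp
    _ ≤ ∫ s in a..t, c ^ 2 * ‖S s x‖ ^ 2 := by
        refine intervalIntegral.integral_mono_on hat (by simp) ((hi a t ha hat).const_mul _)
          fun s hs => ?_
        rw [← mul_pow]
        have : S t = (S (t - s)).comp (S s) := by
          rw [← hS _ _ (sub_nonneg.2 hs.2) (ha.trans hs.1), sub_add_cancel]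
        rw [this]
        gcongr
        exact (S (t - s)).le_of_opNorm_le (hb _ (sub_nonneg.2 hs.2) (by linarith [hs.1])) _
    _ = c ^ 2 * ∫ s in a..t, ‖S s x‖ ^ 2 := by simp
    _ ≤ c ^ 2 * (K * ‖x‖ ^ 2) := by
        gcongr
        refine le_trans ?_ (hK t (ha.trans hat))
        rw [← intervalIntegral.integral_add_adjacent_intervals (hi 0 a le_rfl ha) (hi a t ha hat)]
        have : 0 ≤ ∫ s in (0 : ℝ)..a, ‖S s x‖ ^ 2 :=
          intervalIntegral.integral_nonneg ha fun _ _ => sq_nonneg _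
        linarith
    _ = _ := by ring

theorem exists_exp_bound_of_norm_le_half
    (hS : ∀ s t : ℝ, 0 ≤ s → 0 ≤ t → S (s + t) = (S s).comp (S t))
    {B t₀ : ℝ} (hB : ∀ t, 0 ≤ t → ‖S t‖ ≤ B) (ht₀ : 0 < t₀) (h : ‖S t₀‖ ≤ 1 / 2) :
    ∃ C δ : ℝ, 0 ≤ C ∧ 0 < δ ∧ ∀ t, 0 ≤ t → ‖S t‖ ≤ C * Real.exp (-δ * t) := by
  have hB0 : 0 ≤ B := (norm_nonneg _).trans (hB 0 le_rfl)
  have hl2 : 0 < Real.log 2 := Real.log_pos one_lt_two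
  have hpow : ∀ (n : ℕ) (r : ℝ), 0 ≤ r → ‖S (n * t₀ + r)‖ ≤ (1 / 2) ^ n * B := by
    intro n r hr
    induction n with
    | zero => simpa using hB r hr
    | succ n ih =>
      have : ((n + 1 : ℕ) : ℝ) * t₀ + r = t₀ + (n * t₀ + r) := by push_cast; ring
      rw [this, hS _ _ ht₀.le (by positivity), pow_succ', mul_assoc]
      exact (ContinuousLinearMap.opNorm_comp_le _ _).trans (by gcongr)
  refine ⟨2 * B, Real.log 2 / t₀, by positivity, by positivity, fun t ht => ?_⟩
  have hfl := Nat.floor_le (div_nonneg ht ht₀.le)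
  have hlt := Nat.lt_floor_add_one (t / t₀)
  set n := ⌊t / t₀⌋₊
  have hr : 0 ≤ t - n * t₀ := by
    rw [le_div_iff₀ ht₀] at hfl
    linarith
  have h1 := hpow n _ hr
  rw [add_sub_cancel] at h1
  refine h1.trans ?_
  have h2 : ((1 : ℝ) / 2) ^ n ≤ 2 * Real.exp (-(Real.log 2 / t₀) * t) := by
    calc ((1 : ℝ) / 2) ^ n = Real.exp (-(n * Real.log 2)) := by
          rw [Real.exp_neg, Real.exp_nat_mul, Real.exp_log two_pos]; simp
      _ ≤ Real.exp (Real.log 2 + -(Real.log 2 / t₀) * t) := by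
          gcongr
          have : Real.log 2 / t₀ * t = Real.log 2 * (t / t₀) := by ring
          nlinarith
      _ = _ := by rw [Real.exp_add, Real.exp_log two_pos]
  nlinarith

/-- Datko's theorem: a semigroup with uniformly square-integrable orbits is exponentially
stable. -/
theorem exists_exp_bound_of_integral_sq_le
    (hS : ∀ s t : ℝ, 0 ≤ s → 0 ≤ t → S (s + t) = (S s).comp (S t))
    (hc : ∀ x, ContinuousOn (fun t => S t x) (Set.Ici 0))
    {M K : ℝ} (hM : ∀ t, 0 ≤ t → t ≤ 1 → ‖S t‖ ≤ M) (hK0 : 0 ≤ K)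
    (hK : ∀ x N, 0 ≤ N → ∫ t in (0 : ℝ)..N, ‖S t x‖ ^ 2 ≤ K * ‖x‖ ^ 2) :
    ∃ C δ : ℝ, 0 ≤ C ∧ 0 < δ ∧ ∀ t, 0 ≤ t → ‖S t‖ ≤ C * Real.exp (-δ * t) := by
  have hM0 : 0 ≤ M := (norm_nonneg _).trans (hM 0 le_rfl zero_le_one)
  set B := M + M * √K
  have hB : ∀ t, 0 ≤ t → ‖S t‖ ≤ B := by
    intro t ht
    rcases le_total t 1 with h | h
    · exact (hM t ht h).trans (le_add_of_nonneg_right (by positivity))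
    · refine le_trans ?_ (le_add_of_nonneg_left hM0 : M * √K ≤ B)
      refine ContinuousLinearMap.opNorm_le_bound _ (by positivity) fun x => ?_
      have := mul_sq_norm_orbit_le hS (hc x) (hK x) (sub_nonneg.2 h) (by linarith : t - 1 ≤ t)
        (c := M) fun r hr0 hr1 => hM r hr0 (by linarith)
      refine le_of_sq_le_sq ?_ (by positivity)
      rw [mul_pow, mul_pow, Real.sq_sqrt hK0]
      linarith
  refine exists_exp_bound_of_norm_le_half hS hB (t₀ := 4 * (B ^ 2 * K) + 1) (by positivity) ?_
  refine ContinuousLinearMap.opNorm_le_bound _ (by positivity) fun x => ?_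
  have h0 : 0 ≤ B ^ 2 * K := by positivity
  have := mul_sq_norm_orbit_le hS (hc x) (hK x) le_rfl (t := 4 * (B ^ 2 * K) + 1) (by positivity)
        (c := B) fun r hr0 _ => hB r hr0
  set y := ‖S (4 * (B ^ 2 * K) + 1) x‖
  refine le_of_sq_le_sq ?_ (by positivity)
  have h3 : (4 * (B ^ 2 * K) + 1) * y ^ 2 ≤ (4 * (B ^ 2 * K) + 1) * (1 / 2 * ‖x‖) ^ 2 := by
    nlinarith [sq_nonneg ‖x‖]
  exact le_of_mul_le_mul_left h3 (by positivity)

end Datko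

theorem fourier_indicator_weighted_orbit {X : Type*} [NormedAddCommGroup X] [NormedSpace ℂ X]
    (T : ℝ → (X →L[ℂ] X)) (x : X) (a : ℂ) (ξ : ℝ) :
    𝓕 ((Set.Ioi (0 : ℝ)).indicator fun t : ℝ => Complex.exp (-(a * t)) • T t x) ξ =
      ∫ t in Set.Ioi (0 : ℝ),
        Complex.exp (-((a + (2 * Real.pi * ξ : ℝ) * Complex.I) * t)) • T t x := by
  rw [Real.fourier_eq', ← integral_indicator measurableSet_Ioi]
  refine integral_congr_ae (Filter.Eventually.of_forall fun t => ?_)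
  by_cases ht : t ∈ Set.Ioi (0 : ℝ)
  · simp only [Set.indicator_of_mem ht, smul_smul, ← Complex.exp_add]
    congr 2
    simp
    ring
  · simp [Set.indicator_of_notMem ht]

/-- Plancherel's theorem turns a pointwise comparison of the Laplace transforms of an orbit on two
vertical lines into a comparison of weighted square integrals of the orbit. -/
theorem integral_sq_weighted_orbit_le_of_laplace_le {X : Type*} [NormedAddCommGroup X]
    [InnerProductSpace ℂ X] [CompleteSpace X] {T : ℝ → (X →L[ℂ] X)} {x : X} {M ω : ℝ}
    (hc : ContinuousOn (fun t => T t x) (Set.Ici 0))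
    (hT : ∀ t, 0 ≤ t → ‖T t‖ ≤ M * Real.exp (ω * t)) {α β c : ℝ} (hα : ω < α) (hβ : ω < β)
    (hc0 : 0 ≤ c)
    (h : ∀ s : ℝ,
      ‖∫ t in Set.Ioi (0 : ℝ), Complex.exp (-((α + s * Complex.I) * t)) • T t x‖ ≤
      c * ‖∫ t in Set.Ioi (0 : ℝ), Complex.exp (-((β + s * Complex.I) * t)) • T t x‖) :
    ∫ t in Set.Ioi (0 : ℝ), ‖Complex.exp (-((α : ℂ) * t)) • T t x‖ ^ 2 ≤
      c ^ 2 * ∫ t in Set.Ioi (0 : ℝ), ‖Complex.exp (-((β : ℂ) * t)) • T t x‖ ^ 2 := by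
  have hL1 : ∀ γ : ℝ, ω < γ → Integrable
      ((Set.Ioi (0 : ℝ)).indicator fun t : ℝ => Complex.exp (-((γ : ℂ) * t)) • T t x) :=
    fun γ hγ => (integrable_indicator_iff measurableSet_Ioi).2
      (integrableOn_weighted_orbit hc hT (by simpa using hγ))
  have hsq : ∀ γ t : ℝ,
      ‖(Set.Ioi (0 : ℝ)).indicator (fun t : ℝ => Complex.exp (-((γ : ℂ) * t)) • T t x) t‖ ^ 2 =
      (Set.Ioi (0 : ℝ)).indicator
        (fun t : ℝ => ‖Complex.exp (-((γ : ℂ) * t)) • T t x‖ ^ 2) t := by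
    intro γ t
    by_cases ht : t ∈ Set.Ioi (0 : ℝ)
    · simp only [Set.indicator_of_mem ht]
    · simp [Set.indicator_of_notMem ht]
  have hL2 : ∀ γ : ℝ, ω < γ → MemLp
      ((Set.Ioi (0 : ℝ)).indicator fun t : ℝ => Complex.exp (-((γ : ℂ) * t)) • T t x) 2 := by
    intro γ hγ
    rw [memLp_two_iff_integrable_sq_norm (hL1 γ hγ).aestronglyMeasurable]
    simp only [hsq]
    exact (integrable_indicator_iff measurableSet_Ioi).2
      (integrableOn_sq_weighted_orbit hc hT (by simpa using hγ))
  have := integral_sq_norm_le_of_norm_fourier_le (hL1 α hα) (hL2 α hα) (hL1 β hβ) (hL2 β hβ) hc0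
    fun ξ => by simpa only [fourier_indicator_weighted_orbit] using h (2 * Real.pi * ξ)
  simpa only [hsq, integral_indicator measurableSet_Ioi] using this

/-- If the growth bound may be taken arbitrarily close to `ω ≥ 0`, then some bound below `ω`
holds. -/
theorem exists_growth_bound_lt {X : Type*} [NormedAddCommGroup X] [InnerProductSpace ℂ X]
    [CompleteSpace X] {T : ℝ → (X →L[ℂ] X)} {M₀ ω₀ ω β C₀ : ℝ} (hT0 : T 0 = 1)
    (hTsemi : ∀ s t : ℝ, 0 ≤ s → 0 ≤ t → T (s + t) = (T s).comp (T t))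
    (hTcont : ∀ x : X, ContinuousOn (fun t => T t x) (Set.Ici 0))
    (hTbdd : ∀ t : ℝ, 0 ≤ t → ‖T t‖ ≤ M₀ * Real.exp (ω₀ * t))
    {R : ℂ → (X →L[ℂ] X)}
    (hres : ∀ l μ : ℂ, 0 ≤ l.re → 0 ≤ μ.re → R l - R μ = (μ - l) • ((R l).comp (R μ)))
    (hlap : ∀ l : ℂ, β ≤ l.re → ∀ x : X,
      R l x = ∫ t in Set.Ioi (0:ℝ), Complex.exp (-(l * t)) • T t x)
    (hbdd : ∀ l : ℂ, 0 ≤ l.re → ‖R l‖ ≤ C₀) (hω : 0 ≤ ω) (hβ : ω + 1 ≤ β) (hβ₀ : ω₀ < β)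
    (hgrowth : ∀ α, ω < α → ∃ M, ∃ γ < α, ∀ t, 0 ≤ t → ‖T t‖ ≤ M * Real.exp (γ * t)) :
    ∃ C δ : ℝ, 0 ≤ C ∧ 0 < δ ∧ ∀ t, 0 ≤ t → ‖T t‖ ≤ C * Real.exp ((ω - δ) * t) := by
  have hC₀ : 0 ≤ C₀ := (norm_nonneg _).trans (hbdd 0 le_rfl)
  have hβ0 : 0 ≤ β := by linarith
  set c := 1 + β * C₀ with hcdef
  set K := c ^ 2 * (M₀ ^ 2 / (2 * (β - ω₀))) with hKdef
  have hsub : 0 < β - ω₀ := sub_pos.2 hβ₀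
  have hc0 : 0 ≤ c := by positivity
  have hK0 : 0 ≤ K := by positivity
  have hL2 : ∀ α x, ω < α → α ≤ β →
      IntegrableOn (fun t : ℝ => ‖Complex.exp (-((α : ℂ) * t)) • T t x‖ ^ 2) (Set.Ioi 0) ∧
      ∫ t in Set.Ioi (0 : ℝ), ‖Complex.exp (-((α : ℂ) * t)) • T t x‖ ^ 2 ≤ K * ‖x‖ ^ 2 := by
    intro α x hα hαβ
    obtain ⟨M, γ, hγ, hM⟩ := hgrowth α hα
    refine ⟨integrableOn_sq_weighted_orbit (hTcont x) hM (by simpa using hγ), ?_⟩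
    refine (integral_sq_weighted_orbit_le_of_laplace_le (hTcont x) hM hγ (hγ.trans_le hαβ) hc0
      fun s => ?_).trans ?_
    · have hlα : 0 ≤ ((α : ℂ) + s * Complex.I).re := by simp; linarith
      have hlβ : 0 ≤ ((β : ℂ) + s * Complex.I).re := by simpa using hβ0
      have hβx : ∀ x, _ := hlap ((β : ℂ) + s * Complex.I) (by simp)
      rw [← laplace_eq_resolvent hT0 hTsemi hTcont hM (by simpa using hγ)
        (by simpa using hγ.trans_le hαβ) hβx (hres _ _ hlα hlβ) (hres _ _ hlβ hlα), ← hβx]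
      have e := congrArg (fun A : X →L[ℂ] X => A x) (hres _ _ hlα hlβ)
      simp only [sub_apply, smul_apply,
        ContinuousLinearMap.comp_apply, sub_eq_iff_eq_add'] at e
      rw [e]
      have hn : ‖(β : ℂ) + s * Complex.I - (α + s * Complex.I)‖ ≤ β := by
        rw [add_sub_add_right_eq_sub, ← Complex.ofReal_sub, Complex.norm_real, Real.norm_eq_abs,
          abs_of_nonneg (by linarith)]
        linarith
      refine (norm_add_le _ _).trans ?_
      rw [norm_smul, hcdef, add_mul, one_mul, mul_assoc]
      gcongr
      exact (R _).le_of_opNorm_le (hbdd _ hlα) _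
    · rw [hKdef, mul_assoc]
      gcongr
      simpa using integral_sq_weighted_orbit_le (l := (β : ℂ)) (hTcont x) hTbdd (by simpa using hβ₀)
  set S : ℝ → (X →L[ℂ] X) := fun t => (Real.exp (-ω * t) : ℂ) • T t with hSdef
  have hnS : ∀ t, ‖S t‖ = Real.exp (-ω * t) * ‖T t‖ := fun t => by
    rw [hSdef, norm_smul, Complex.norm_real, Real.norm_eq_abs, Real.abs_exp]
  have hnSx : ∀ t x, ‖S t x‖ = Real.exp (-ω * t) * ‖T t x‖ := fun t x => by
    simp only [hSdef, smul_apply]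
    rw [norm_smul, Complex.norm_real, Real.norm_eq_abs, Real.abs_exp]
  have hSc : ∀ x, ContinuousOn (fun t => S t x) (Set.Ici 0) := fun x =>
    ContinuousOn.smul (by fun_prop) (hTcont x)
  have hSsemi : ∀ s t : ℝ, 0 ≤ s → 0 ≤ t → S (s + t) = (S s).comp (S t) := by
    intro s t hs ht
    simp only [hSdef]
    rw [hTsemi s t hs ht, ContinuousLinearMap.smul_comp, ContinuousLinearMap.comp_smul, smul_smul,
      ← Complex.ofReal_mul, ← Real.exp_add, mul_add]
  have hSM : ∀ t, 0 ≤ t → t ≤ 1 → ‖S t‖ ≤ |M₀| * Real.exp |ω₀| := by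
    intro t ht0 ht1
    rw [hnS]
    calc _ ≤ 1 * (|M₀| * Real.exp |ω₀|) := by
          gcongr
          · rw [Real.exp_le_one_iff]; nlinarith
          · refine (hTbdd t ht0).trans ?_
            gcongr
            · exact le_abs_self _
            · nlinarith [le_abs_self ω₀, abs_nonneg ω₀]
      _ = _ := one_mul _
  obtain ⟨C, δ, hC, hδ, h⟩ := exists_exp_bound_of_integral_sq_le hSsemi hSc hSM
    (K := Real.exp 2 * K) (by positivity) fun x N hN => by
      have hN1 : 0 < N + 1 := by linarith
      have hN2 : 1 / (N + 1) ≤ 1 := by rw [div_le_one hN1]; linarith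
      obtain ⟨hint, hle⟩ := hL2 (ω + 1 / (N + 1)) x (lt_add_of_pos_right _ (by positivity))
        (by linarith)
      rw [intervalIntegral.integral_of_le hN]
      calc ∫ t in Set.Ioc 0 N, ‖S t x‖ ^ 2
          ≤ ∫ t in Set.Ioc 0 N, Real.exp 2 *
            ‖Complex.exp (-(((ω + 1 / (N + 1) : ℝ) : ℂ) * t)) • T t x‖ ^ 2 := by
            refine setIntegral_mono_on ?_
              ((hint.mono_set Set.Ioc_subset_Ioi_self).const_mul _) measurableSet_Ioc
              fun t ht => ?_
            · exact (((hSc x).norm.pow 2).mono Set.Icc_subset_Ici_self).integrableOn_Icc.mono_set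
                Set.Ioc_subset_Icc_self
            · rw [hnSx, norm_smul, mul_pow, mul_pow, ← mul_assoc, Complex.norm_exp]
              gcongr
              rw [← Real.exp_nat_mul, ← Real.exp_nat_mul, ← Real.exp_add]
              gcongr
              have h1 : 1 / (N + 1) * t ≤ 1 := by
                rw [one_div_mul_eq_div, div_le_one hN1]; linarith [ht.2]
              rw [← Complex.ofReal_mul, ← Complex.ofReal_neg, Complex.ofReal_re]
              push_cast
              linarith
        _ ≤ ∫ t in Set.Ioi (0 : ℝ), Real.exp 2 *
            ‖Complex.exp (-(((ω + 1 / (N + 1) : ℝ) : ℂ) * t)) • T t x‖ ^ 2 :=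
            setIntegral_mono_set (hint.const_mul _)
              (Filter.Eventually.of_forall fun t => by positivity)
              (Filter.Eventually.of_forall Set.Ioc_subset_Ioi_self)
        _ ≤ Real.exp 2 * K * ‖x‖ ^ 2 := by
            rw [integral_const_mul, mul_assoc]
            gcongr
  refine ⟨C, δ, hC, hδ, fun t ht => ?_⟩
  have := h t ht
  rw [hnS] at this
  calc ‖T t‖ = Real.exp (ω * t) * (Real.exp (-ω * t) * ‖T t‖) := by
        rw [← mul_assoc, ← Real.exp_add]; simp
    _ ≤ Real.exp (ω * t) * (C * Real.exp (-δ * t)) := by gcongr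
    _ = C * (Real.exp (ω * t) * Real.exp (-δ * t)) := by ring
    _ = _ := by rw [← Real.exp_add]; ring_nf

/-- The Gearhart–Prüss theorem: on a Hilbert space, uniform boundedness of
the resolvent on the closed right half-plane implies exponential stability: there are
`C ≥ 0` and `ω < 0` with `‖T(t)‖ ≤ C e^{ωt}` for all `t ≥ 0`. -/
theorem gearhart_pruess
    {X : Type*} [NormedAddCommGroup X] [InnerProductSpace ℂ X] [CompleteSpace X]
    (T : ℝ → (X →L[ℂ] X)) (M₀ ω₀ : ℝ) (hM₀ : 1 ≤ M₀)
    (hT0 : T 0 = 1)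
    (hTsemi : ∀ s t : ℝ, 0 ≤ s → 0 ≤ t → T (s + t) = (T s).comp (T t))
    (hTcont : ∀ x : X, ContinuousOn (fun t => T t x) (Set.Ici 0))
    (hTbdd : ∀ t : ℝ, 0 ≤ t → ‖T t‖ ≤ M₀ * Real.exp (ω₀ * t))
    (R : ℂ → (X →L[ℂ] X))
    (hres : ∀ l μ : ℂ, (0 ≤ l.re ∨ ω₀ < l.re) → (0 ≤ μ.re ∨ ω₀ < μ.re) →
      R l - R μ = (μ - l) • ((R l).comp (R μ)))
    (hlap : ∀ l : ℂ, max ω₀ 0 < l.re → ∀ x : X,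
      R l x = ∫ t in Set.Ioi (0:ℝ), Complex.exp (-(l * t)) • T t x)
    (C₀ : ℝ) (hbdd : ∀ l : ℂ, 0 ≤ l.re → ‖R l‖ ≤ C₀) :
    ∃ C : ℝ, 0 ≤ C ∧ ∃ ω : ℝ, ω < 0 ∧
      ∀ t : ℝ, 0 ≤ t → ‖T t‖ ≤ C * Real.exp (ω * t) := by
  set G : Set ℝ := {ω | 0 ≤ ω ∧ ∃ M, ∀ t, 0 ≤ t → ‖T t‖ ≤ M * Real.exp (ω * t)}
  have hmem : max ω₀ 0 ∈ G := by
    refine ⟨le_max_right _ _, M₀, fun t ht => (hTbdd t ht).trans ?_⟩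
    gcongr
    exact le_max_left _ _
  have hbelow : BddBelow G := ⟨0, fun ω hω => hω.1⟩
  have hinf0 : 0 ≤ sInf G := le_csInf ⟨_, hmem⟩ fun ω hω => hω.1
  have hinf1 : sInf G ≤ max ω₀ 0 := csInf_le hbelow hmem
  obtain ⟨C, δ, hC, hδ, h⟩ := exists_growth_bound_lt (β := max ω₀ 0 + 1) hT0 hTsemi hTcont hTbdd
    (fun l μ hl hμ => hres l μ (Or.inl hl) (Or.inl hμ)) (fun l hl => hlap l (by linarith)) hbdd
    hinf0 (by linarith) (by linarith [le_max_left ω₀ 0]) fun α hα => by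
      obtain ⟨γ, ⟨-, M, hM⟩, hγ⟩ := exists_lt_of_csInf_lt ⟨_, hmem⟩ hα
      exact ⟨M, γ, hγ, hM⟩
  refine ⟨C, hC, sInf G - δ, ?_, h⟩
  by_contra! hneg
  have : sInf G ≤ sInf G - δ := csInf_le hbelow ⟨hneg, C, h⟩
  linarith
end
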